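/- Let n ≥ 1 and let A = (a_{uv})_{u,v=1,…,n} : ℝⁿ → Mₙ(ℝ) be a smooth map such that A(p) is an orthogonal matrix for every p ∈ ℝⁿ. Then A is integrable — i.e., for all i, k ∈ {1,…,n}, (I+A){(I−A)dx_i, (I−A)dx_k} = (I−A)[X_{(I−A)dx_i}, X_{(I−A)dx_k}] — if and only if for all m, i, k ∈ {1,…,n}: ∂_i(a_{mk}) − ∂_k(a_{mi}) + Σ_{l=1}^{n} ( a_{li} ∂_l(a_{mk}) − a_{lk} ∂_l(a_{mi}) ) + Σ_{j=1}^{n} a_{ji} ∂_m(a_{jk}) + Σ_{l,j=1}^{n} a_{mj} a_{lj} ∂_j(a_{lk}) = 0 identically on ℝⁿ. -/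

import Mathlib

open Matrix
open scoped BigOperators

variable {n : ℕ}

/-- The partial derivative `∂_j f` of `f : ℝⁿ → ℝ` at `p`. -/
noncomputable def pd (j : Fin n) (f : (Fin n → ℝ) → ℝ) (p : Fin n → ℝ) : ℝ :=
  fderiv ℝ f p (Pi.single j 1)

/-- The components of the 1-form `(I − A)dx_i` (equivalently of the vector field
`X_{(I−A)dx_i}`): the `j`-th component is `δ_{ji} − a_{ji}`. -/
def alphaForm (a : (Fin n → ℝ) → Matrix (Fin n) (Fin n) ℝ) (i : Fin n) :
    (Fin n → ℝ) → Fin n → ℝ :=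
  fun p j => (if j = i then (1 : ℝ) else 0) - a p j i

/-- The contraction `X(dω)`: its `l`-th component is `Σ_t X_t (∂_t ω_l − ∂_l ω_t)`. -/
noncomputable def contrD (X ω : (Fin n → ℝ) → Fin n → ℝ) (p : Fin n → ℝ) (l : Fin n) : ℝ :=
  ∑ t : Fin n, X p t * (pd t (fun q => ω q l) p - pd l (fun q => ω q t) p)

/-- The function `X(ω) = Σ_j X_j ω_j`. -/
noncomputable def pairF (X ω : (Fin n → ℝ) → Fin n → ℝ) (p : Fin n → ℝ) : ℝ :=
  ∑ j : Fin n, X p j * ω p j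

/-- The bracket of 1-forms `{ω, μ} = X_ω(dμ) − X_μ(dω) + (1/2) d(X_ω(μ) − X_μ(ω))`,
with `X_ω` identified with the component vector of `ω`. -/
noncomputable def formBracket (ω μ : (Fin n → ℝ) → Fin n → ℝ) (p : Fin n → ℝ) :
    Fin n → ℝ :=
  fun l => contrD ω μ p l - contrD μ ω p l
    + (1 / 2) * pd l (fun q => pairF ω μ q - pairF μ ω q) p

/-- The Lie bracket of vector fields: `[X,Y]_l = Σ_j (X_j ∂_j Y_l − Y_j ∂_j X_l)`. -/
noncomputable def lieBracket (X Y : (Fin n → ℝ) → Fin n → ℝ) (p : Fin n → ℝ) :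
    Fin n → ℝ :=
  fun l => ∑ j : Fin n, (X p j * pd j (fun q => Y q l) p - Y p j * pd j (fun q => X q l) p)

lemma curve_lower {u v w : ℝ} (hw0 : 0 < w) (hw1 : w ≤ 1)
    (hI : (3 * u + 7) * v = u ^ 2 + 9 * u - 2 * w)
    (hR : 2 - 6 * u = (1 - w) * (2 - u - v - 4 * v ^ 2)) : w ≤ 3 * u := by
  by_contra! h
  have key : (1 - w) * (u + v + 4 * v ^ 2) + (2 * w - 6 * u) = 0 := by linarith
  have h4 : -(1/16) ≤ v + 4 * v ^ 2 := by nlinarith [sq_nonneg (v + 1/8)]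
  by_cases hu : u ≤ -1
  · nlinarith
  push Not at hu
  have hX : 0 < 3 * u + 7 := by linarith
  have h5 : 0 < (3 * u + 7) * ((1 - w) * (u + v) + (2 * w - 6 * u)) := by
    have : (3 * u + 7) * ((1 - w) * (u + v) + (2 * w - 6 * u))
       = -14*u^2 - 26*u + 12*w - 4*u^2*w - 10*u*w + 2*w^2 := by
      linear_combination (1 - w) * hI
    rw [this]
    have h6 : 0 ≤ (w / 3 - u) * (u + 1) := mul_nonneg (by linarith) (by linarith)
    nlinarith [mul_nonneg h6 hw0.le, mul_nonneg hw0.le (sub_nonneg.2 hw1), mul_pos hw0 (sub_pos.2 h)]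
  have h7 : 0 < (1 - w) * (u + v) + (2 * w - 6 * u) := by
    exact (mul_pos_iff_of_pos_left hX).1 h5
  nlinarith [mul_nonneg (sub_nonneg.2 hw1) (sq_nonneg v)]

lemma curve_T_pos {y g E : ℝ} (hE0 : 0 ≤ E) (hE1 : E < 1)
    (hI : 2 * E = 2 + 9 * y - y ^ 2 + (3 * y - 7) * g)
    (hR : 2 + 6 * y + E * (4 * g ^ 2 - g - 2 - y) = 0) :
    0 < y ^ 2 * (8 - 4 * E) + y * (-12 + 6 * E - 4 * E * g) - 4
      + E * (8 * g ^ 2 - 26 * g + 6) - E ^ 2 * (2 + 4 * g) := by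
  obtain ⟨u, rfl⟩ : ∃ u, y = -u := ⟨-y, by ring⟩
  obtain ⟨v, rfl⟩ : ∃ v, g = -v := ⟨-g, by ring⟩
  obtain ⟨w, rfl⟩ : ∃ w, E = 1 - w := ⟨1 - E, by ring⟩
  have h1 : (3 * u + 7) * v = u ^ 2 + 9 * u - 2 * w := by linarith
  have hu : w ≤ 3 * u := curve_lower (by linarith) (by linarith) h1 (by linarith)
  have hw0 : 0 < w := by linarith
  set E := 1 - w with hE
  have hX : 0 < 3 * u + 7 := by linarith
  have hT : (3 * u + 7) * (u ^ 2 * (4 - 3 * E) - u * (12 - E) + u * v * (12 - 7 * E)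
      + v * (28 + 17 * E + 4 * E ^ 2)) = u ^ 3 * (24 - 16 * E) + u ^ 2 * (128 - 64 * E + 4 * E ^ 2)
      + u * (144 + 198 * E + 22 * E ^ 2) - 2 * w * (28 + 17 * E + 4 * E ^ 2) := by
    rw [hE]; linear_combination (u * (12 - 7 * (1 - w)) + (28 + 17 * (1 - w) + 4 * (1 - w) ^ 2)) * h1
  have hpos : 0 < u ^ 3 * (24 - 16 * E) + u ^ 2 * (128 - 64 * E + 4 * E ^ 2)
      + u * (144 + 198 * E + 22 * E ^ 2) - 2 * w * (28 + 17 * E + 4 * E ^ 2) := by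
    have h3 : 0 ≤ u ^ 3 * (24 - 16 * E) := mul_nonneg (pow_nonneg (by linarith) 3) (by linarith)
    have h2 : (w / 3) ^ 2 * (128 - 64 * E + 4 * E ^ 2) ≤ u ^ 2 * (128 - 64 * E + 4 * E ^ 2) := by
      apply mul_le_mul_of_nonneg_right
      · apply pow_le_pow_left₀ <;> linarith
      · nlinarith
    have h4 : (w / 3) * (144 + 198 * E + 22 * E ^ 2) ≤ u * (144 + 198 * E + 22 * E ^ 2) := by
      apply mul_le_mul_of_nonneg_right
      · linarith
      · nlinarith [sq_nonneg E]
    have h5 : 0 < w * (-8 + 32 * E - (2/3) * E ^ 2 + w * (128 - 64 * E + 4 * E ^ 2) / 9) := by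
      apply mul_pos hw0
      rw [show w = 1 - E by rw [hE]; ring]
      nlinarith [mul_nonneg hE0 (sub_nonneg.2 hE1.le), mul_nonneg (mul_nonneg hE0 (sub_nonneg.2 hE1.le)) hE0]
    nlinarith
  have hfin := (mul_pos_iff_of_pos_left hX).1 (hT ▸ hpos)
  have : (-u) ^ 2 * (8 - 4 * E) + (-u) * (-12 + 6 * E - 4 * E * (-v)) - 4
      + E * (8 * (-v) ^ 2 - 26 * (-v) + 6) - E ^ 2 * (2 + 4 * (-v)) =
      u ^ 2 * (4 - 3 * E) - u * (12 - E) + u * v * (12 - 7 * E)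
      + v * (28 + 17 * E + 4 * E ^ 2) := by
    rw [hE] at hI hR ⊢
    linear_combination 2 * hR + (4 - (1 - w)) * hI
  rw [this]; exact hfin

lemma curve_disc_identity {y g E : ℝ}
    (hI : 2 * E = 2 + 9 * y - y ^ 2 + (3 * y - 7) * g)
    (hR : 2 + 6 * y + E * (4 * g ^ 2 - g - 2 - y) = 0) :
    (E * y ^ 2 - 4 * y ^ 3 - 4 * E ^ 2 * g + 18 * E * y * g - 27 * E * g ^ 2)
        * (8 * g ^ 2 + 18 * g + 65) =
      (1 - E) * (80 - 44 * g - 8 * g ^ 2 + 540 * g ^ 3 + 560 * g ^ 4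
        + y * (460 + 652 * g - 1180 * g ^ 2 - 796 * g ^ 3 - 240 * g ^ 4)
        + y ^ 2 * (380 + 96 * g + 28 * g ^ 2 - 16 * g ^ 3)) := by
  obtain rfl : E = (2 + 9 * y - y ^ 2 + (3 * y - 7) * g) / 2 := by linarith
  linear_combination (2 * (-45 + (137 / 2) * g + 57 * g ^ 2 - (445 / 2) * y - 122 * y * g
    - 36 * y * g ^ 2)) * hR

lemma curve_g_neg {y g E : ℝ} (hE1 : 1 < E)
    (hI : 2 * E = 2 + 9 * y - y ^ 2 + (3 * y - 7) * g)
    (hR : 2 + 6 * y + E * (4 * g ^ 2 - g - 2 - y) = 0)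
    (h1 : 3 * y ≤ E) (h2 : 3 * E * g ≤ y ^ 2) : g < 0 := by
  by_contra! hg
  have hy : 0 < y := by
    by_contra! hy
    nlinarith
  have hgy : 9 * g ≤ y := by
    have : 9 * g * y ≤ y * y := by nlinarith
    exact le_of_mul_le_mul_right this hy
  have hy5 : y ≤ 26/5 := by nlinarith
  have hF : 2 + 41 / 5 * y - 2 / 3 * y ^ 2 ≤ 2 * E := by
    nlinarith
  have hF2 : 2 + 4/5 * y ≤ 2 + y + g - 4 * g ^ 2 := by nlinarith
  nlinarith [mul_le_mul hF hF2 (by positivity) (by linarith)]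

lemma bernstein_basis_nonneg {v lo hi : ℝ} (h : lo ≤ v) (h' : v ≤ hi) (i j : ℕ) :
    0 ≤ (v - lo) ^ i * (hi - v) ^ j :=
  mul_nonneg (pow_nonneg (sub_nonneg.2 h) i) (pow_nonneg (sub_nonneg.2 h') j)

lemma curve_y_lower {y v E : ℝ} (hE1 : 1 < E)
    (hI' : 2 * E = 2 + 9 * y - y ^ 2 + (7 - 3 * y) * v)
    (hR' : E * (2 + y - v - 4 * v ^ 2) = 2 + 6 * y) (hy : 0 < y) (h' : 31 / 50 < v) :
    8 / 5 ≤ y := by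
  by_contra! hlt
  obtain ⟨d, rfl⟩ : ∃ d, v = 31 / 50 + d := ⟨v - 31 / 50, by ring⟩
  have hh : 0 < d := by linarith
  have e1 : E * (2 + y - (31 / 50 + d) - 4 * (31 / 50 + d) ^ 2)
      ≤ E * (y - 0.1576 - 5.96 * d) := by
    apply mul_le_mul_of_nonneg_left _ (by linarith)
    nlinarith
  have e2 : 2 * E = 6.34 + 7.14 * y - y ^ 2 + (7 - 3 * y) * d := by linarith
  have e3 : (6.34 + 7.14 * y - y ^ 2) * (y - 0.1576) < 4 + 12 * y := by
    nlinarith [mul_pos hy (sub_pos.2 hlt), mul_pos hy hy]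
  have e4 : 0 ≤ d * (5.96 * (6.34 + 7.14 * y - y ^ 2) - (7 - 3 * y) * (y - 0.1576)) :=
    mul_nonneg hh.le (by nlinarith)
  have e5 : 0 ≤ (7 - 3 * y) * d ^ 2 := mul_nonneg (by linarith) (sq_nonneg d)
  have e6 : 2 * E * (y - 0.1576 - 5.96 * d)
      = (6.34 + 7.14 * y - y ^ 2 + (7 - 3 * y) * d) * (y - 0.1576 - 5.96 * d) := by rw [e2]
  linarith

lemma curve_v_upper {y v E : ℝ} (hE1 : 1 < E)
    (hI' : 2 * E = 2 + 9 * y - y ^ 2 + (7 - 3 * y) * v)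
    (hR' : E * (2 + y - v - 4 * v ^ 2) = 2 + 6 * y) (hy : 0 < y) : v ≤ 4 / 5 := by
  by_contra! hlt
  obtain ⟨d, rfl⟩ : ∃ d, v = 4 / 5 + d := ⟨v - 4 / 5, by ring⟩
  have hh : 0 < d := by linarith
  have e1 : E * (2 + y - (4 / 5 + d) - 4 * (4 / 5 + d) ^ 2)
      ≤ E * (y - 1.36 - 7.4 * d) := by
    apply mul_le_mul_of_nonneg_left _ (by linarith)
    nlinarith [sq_nonneg d]
  have e2 : 2 * E = 7.6 + 6.6 * y - y ^ 2 + (7 - 3 * y) * d := by linarith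
  have e3 : (7.6 + 6.6 * y - y ^ 2) * (y - 1.36) < 4 + 12 * y := by
    nlinarith [mul_nonneg hy.le (sq_nonneg (y - 4.2)), sq_nonneg (y - 4.845)]
  rcases le_or_gt (7 / 3) y with h3 | h3
  · have e4 : 2 * E * (y - 1.36) ≤ (7.6 + 6.6 * y - y ^ 2) * (y - 1.36) :=
      mul_le_mul_of_nonneg_right (by nlinarith) (by linarith)
    nlinarith [sq_nonneg d]
  have e4 : 0 ≤ d * (7.4 * (7.6 + 6.6 * y - y ^ 2) - (7 - 3 * y) * (y - 1.36)) :=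
    mul_nonneg hh.le (by nlinarith [mul_pos hy (sub_pos.2 h3)])
  have e5 : 0 ≤ (7 - 3 * y) * d ^ 2 := mul_nonneg (by linarith) (sq_nonneg d)
  have e6 : 2 * E * (y - 1.36 - 7.4 * d)
      = (7.6 + 6.6 * y - y ^ 2 + (7 - 3 * y) * d) * (y - 1.36 - 7.4 * d) := by rw [e2]
  linarith

set_option maxHeartbeats 1600000 in
lemma curve_M_pos {y g E : ℝ} (hE1 : 1 < E)
    (hI : 2 * E = 2 + 9 * y - y ^ 2 + (3 * y - 7) * g)
    (hR : 2 + 6 * y + E * (4 * g ^ 2 - g - 2 - y) = 0) (hg : g < 0)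
    (h1 : 3 * y ≤ E) :
    0 < 80 - 44 * g - 8 * g ^ 2 + 540 * g ^ 3 + 560 * g ^ 4
        + y * (460 + 652 * g - 1180 * g ^ 2 - 796 * g ^ 3 - 240 * g ^ 4)
        + y ^ 2 * (380 + 96 * g + 28 * g ^ 2 - 16 * g ^ 3) := by
  obtain ⟨v, rfl⟩ : ∃ v, g = -v := ⟨-g, by ring⟩
  have hv : 0 < v := by linarith
  have hc0 : 0 < 80 + 44 * v - 8 * v ^ 2 - 540 * v ^ 3 + 560 * v ^ 4 := by
    nlinarith [sq_nonneg (v ^ 2 - v / 2), sq_nonneg (v ^ 2 - v / 2 - 1/9), sq_nonneg (v - 2/3)]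
  have hc2 : 300 ≤ 380 - 96 * v + 28 * v ^ 2 + 16 * v ^ 3 := by
    nlinarith [sq_nonneg (v - 1), mul_pos hv hv]
  suffices h : 0 < 80 + 44 * v - 8 * v ^ 2 - 540 * v ^ 3 + 560 * v ^ 4
      + y * (460 - 652 * v - 1180 * v ^ 2 + 796 * v ^ 3 - 240 * v ^ 4)
      + y ^ 2 * (380 - 96 * v + 28 * v ^ 2 + 16 * v ^ 3) by
    convert h using 1; ring
  set c0 := 80 + 44 * v - 8 * v ^ 2 - 540 * v ^ 3 + 560 * v ^ 4 with hc0d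
  set c1 := 460 - 652 * v - 1180 * v ^ 2 + 796 * v ^ 3 - 240 * v ^ 4 with hc1d
  set c2 := 380 - 96 * v + 28 * v ^ 2 + 16 * v ^ 3 with hc2d
  have hI' : 2 * E = 2 + 9 * y - y ^ 2 + (7 - 3 * y) * v := by linarith
  have hR' : E * (2 + y - v - 4 * v ^ 2) = 2 + 6 * y := by linarith
  rcases le_or_gt y 0 with hy | hy
  · have hv1 : 3 / 20 ≤ v := by
      by_contra! hlt
      have hy2 : -(5 / 6) * v < y := by nlinarith
      nlinarith [mul_pos hv (sub_pos.2 hE1), mul_pos hv (sub_pos.2 hlt)]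
    rcases le_or_gt (9 / 20) v with h | h
    · have : c1 ≤ 0 := by rw [hc1d]; nlinarith [sq_nonneg (v ^ 2 - 8 / 5 * v), mul_pos hv hv]
      nlinarith [mul_nonneg_of_nonpos_of_nonpos hy this, sq_nonneg y]
    rcases le_or_gt (1 / 4) v with h' | h'
    · have B := bernstein_basis_nonneg h' h.le
      have a1 : c1 ≤ 236 := by rw [hc1d]; linarith [B 0 4, B 1 3, B 2 2, B 3 1, B 4 0]
      have a0 : 70 ≤ c0 := by rw [hc0d]; linarith [B 0 4, B 1 3, B 2 2, B 3 1, B 4 0]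
      nlinarith [sq_nonneg (300 * y + 118)]
    · have B := bernstein_basis_nonneg hv1 h'.le
      have a1 : c1 ≤ 339 := by rw [hc1d]; linarith [B 0 4, B 1 3, B 2 2, B 3 1, B 4 0]
      have a0 : 83 ≤ c0 := by rw [hc0d]; linarith [B 0 4, B 1 3, B 2 2, B 3 1, B 4 0]
      have a2 : 355 ≤ c2 := by rw [hc2d]; linarith [B 0 4, B 1 3, B 2 2, B 3 1, B 4 0]
      nlinarith [sq_nonneg (355 * y + 339 / 2), mul_nonneg (sub_nonneg.2 a2) (sq_nonneg y),
        mul_nonneg (sub_nonneg.2 a1) (neg_nonneg.2 hy)]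
  · rcases le_or_gt v (11 / 25) with h | h
    · have B := bernstein_basis_nonneg hv.le h
      have : 0 ≤ c1 := by rw [hc1d]; linarith [B 0 4, B 1 3, B 2 2, B 3 1, B 4 0]
      positivity
    rcases le_or_gt v (31 / 50) with h' | h'
    · have B := bernstein_basis_nonneg h.le h'
      have a1 : -245 ≤ c1 := by rw [hc1d]; linarith [B 0 4, B 1 3, B 2 2, B 3 1, B 4 0]
      have a0 : 57 ≤ c0 := by rw [hc0d]; linarith [B 0 4, B 1 3, B 2 2, B 3 1, B 4 0]
      have a2 : 330 ≤ c2 := by rw [hc2d]; linarith [B 0 4, B 1 3, B 2 2, B 3 1, B 4 0]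
      nlinarith [sq_nonneg (330 * y - 245 / 2), mul_nonneg (sub_nonneg.2 a2) (sq_nonneg y),
        mul_nonneg (sub_nonneg.2 a1) hy.le]
    have hF : 0 < 2 + y - v - 4 * v ^ 2 := by
      by_contra! hF
      nlinarith
    have hy1 : 8 / 5 ≤ y := curve_y_lower hE1 hI' hR' hy h'
    have hv8 : v ≤ 4 / 5 := curve_v_upper hE1 hI' hR' hy
    have B := bernstein_basis_nonneg h'.le hv8
    have a1 : -510 ≤ c1 := by rw [hc1d]; linarith [B 0 4, B 1 3, B 2 2, B 3 1, B 4 0]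
    have a2 : 320 ≤ c2 := by rw [hc2d]; linarith [B 0 4, B 1 3, B 2 2, B 3 1, B 4 0]
    have : 0 < y * (c1 + y * c2) := mul_pos hy (by nlinarith)
    nlinarith

open Complex in
lemma triple_det {p q r : ℝ} {a b c : ℂ}
    (h1 : (1 - I * q) * (1 + I * r) * b + (1 + I * q) * (1 - I * r) * c = p * (2 * I - q - r) * a)
    (h2 : (1 - I * r) * (1 + I * p) * c + (1 + I * r) * (1 - I * p) * a = q * (2 * I - r - p) * b)
    (h3 : (1 - I * p) * (1 + I * q) * a + (1 + I * p) * (1 - I * q) * b = r * (2 * I - p - q) * c)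
    {e1 e2 e3 : ℝ} (he1 : e1 = p + q + r) (he2 : e2 = p * q + q * r + r * p)
    (he3 : e3 = p * q * r) (ha : a ≠ 0) :
    2 + 6 * e2 - 2 * e1 ^ 2 - e1 ^ 2 * e2 - e1 * e3 + 4 * e3 ^ 2 = 0 ∧
      2 * e1 + 9 * e1 * e2 - 2 * e1 ^ 3 - e1 * e2 ^ 2 - 7 * e3 + 3 * e2 * e3 = 0 := by
  have key : (((2 + 6 * e2 - 2 * e1 ^ 2 - e1 ^ 2 * e2 - e1 * e3 + 4 * e3 ^ 2 : ℝ) : ℂ) +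
      ((2 * e1 + 9 * e1 * e2 - 2 * e1 ^ 3 - e1 * e2 ^ 2 - 7 * e3 + 3 * e2 * e3 : ℝ) : ℂ) * I) * a
      = 0 := by
    subst he1 he2 he3
    push_cast
    have hI : (I : ℂ) ^ 2 = -1 := I_sq
    have hI3 : (I : ℂ) ^ 3 = -I := by rw [pow_succ, hI]; ring
    have hI4 : (I : ℂ) ^ 4 = 1 := by rw [show 4 = 2 * 2 by norm_num, pow_mul, hI]; ring
    have hI5 : (I : ℂ) ^ 5 = I := by rw [pow_succ, hI4]; ring
    have hI6 : (I : ℂ) ^ 6 = -1 := by rw [pow_succ, hI5, ← hI]; ring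
    have := congr_arg₂ (· + ·) (congr_arg₂ (· + ·)
      (congr_arg (((q * (2 * I - r - p)) * (r * (2 * I - p - q))
        - (1 - I * r) * (1 + I * p) * ((1 + I * p) * (1 - I * q))) * ·) h1)
      (congr_arg (((1 - I * q) * (1 + I * r) * (r * (2 * I - p - q))
        + (1 + I * q) * (1 - I * r) * ((1 + I * p) * (1 - I * q))) * ·) h2))
      (congr_arg (((1 - I * q) * (1 + I * r) * ((1 - I * r) * (1 + I * p))
        + (1 + I * q) * (1 - I * r) * (q * (2 * I - r - p))) * ·) h3)
    rw [← sub_eq_zero] at this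
    ring_nf at this ⊢
    simp only [hI, hI3, hI4, hI5, hI6] at this ⊢
    linear_combination this
  have split : ∀ x y : ℝ, (x : ℂ) + y * I = 0 → x = 0 ∧ y = 0 := fun x y h =>
    ⟨by simpa using congr_arg re h, by simpa using congr_arg im h⟩
  rcases mul_eq_zero.1 key with h | h
  · exact split _ _ h
  · exact absurd h ha

lemma triple_norm_identity_real {p q r e a1 a2 b1 b2 c1 c2 u1 u2 w1 w2 : ℝ}
    (ha1 : (1 - p ^ 2) * a1 - (e - p) * a2 = u1 - p * w1)
    (ha2 : (1 - p ^ 2) * a2 + (e - p) * a1 = u2 - p * w2)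
    (hb1 : (1 - q ^ 2) * b1 - (e - q) * b2 = u1 - q * w1)
    (hb2 : (1 - q ^ 2) * b2 + (e - q) * b1 = u2 - q * w2)
    (hc1 : (1 - r ^ 2) * c1 - (e - r) * c2 = u1 - r * w1)
    (hc2 : (1 - r ^ 2) * c2 + (e - r) * c1 = u2 - r * w2)
    (hw1 : w1 = p * a1 + q * b1 + r * c1 - (a2 + b2 + c2))
    (hw2 : w2 = p * a2 + q * b2 + r * c2 + (a1 + b1 + c1))
    (hu1 : u1 = -(e * (a2 + b2 + c2) + (p * a2 + q * b2 + r * c2)) / 2)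
    (hu2 : u2 = (e * (a1 + b1 + c1) + (p * a1 + q * b1 + r * c1)) / 2)
    (hm1 : p ^ 2 * a1 + q ^ 2 * b1 + r ^ 2 * c1 = -(a1 + b1 + c1) + e * w1 + 2 * w2 - u1)
    (hm2 : p ^ 2 * a2 + q ^ 2 * b2 + r ^ 2 * c2 = -(a2 + b2 + c2) + e * w2 - 2 * w1 - u2) :
    ((1 + p ^ 2) * (a1 ^ 2 + a2 ^ 2) + (1 + q ^ 2) * (b1 ^ 2 + b2 ^ 2)
      + (1 + r ^ 2) * (c1 ^ 2 + c2 ^ 2) - (w1 ^ 2 + w2 ^ 2)) * (1 - e ^ 2) =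
      w1 ^ 2 + w2 ^ 2 + e * (u1 * w1 + u2 * w2) + 3 * (u2 * w1 - u1 * w2)
        - 2 * (u1 ^ 2 + u2 ^ 2) := by
  have hR := show (1 - p ^ 2) * (a1 ^ 2 + a2 ^ 2) + (1 - q ^ 2) * (b1 ^ 2 + b2 ^ 2)
      + (1 - r ^ 2) * (c1 ^ 2 + c2 ^ 2) = u1 * (a1 + b1 + c1) + u2 * (a2 + b2 + c2)
        - w1 * (p * a1 + q * b1 + r * c1) - w2 * (p * a2 + q * b2 + r * c2) by
    linear_combination a1 * ha1 + a2 * ha2 + b1 * hb1 + b2 * hb2 + c1 * hc1 + c2 * hc2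
  have hI := show (e - p) * (a1 ^ 2 + a2 ^ 2) + (e - q) * (b1 ^ 2 + b2 ^ 2)
      + (e - r) * (c1 ^ 2 + c2 ^ 2) = u2 * (a1 + b1 + c1) - u1 * (a2 + b2 + c2)
        - w2 * (p * a1 + q * b1 + r * c1) + w1 * (p * a2 + q * b2 + r * c2) by
    linear_combination a1 * ha2 - a2 * ha1 + b1 * hb2 - b2 * hb1 + c1 * hc2 - c2 * hc1
  have hJ := show p * (e - p) * (a1 ^ 2 + a2 ^ 2) + q * (e - q) * (b1 ^ 2 + b2 ^ 2)
      + r * (e - r) * (c1 ^ 2 + c2 ^ 2)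
        = u2 * (p * a1 + q * b1 + r * c1) - u1 * (p * a2 + q * b2 + r * c2)
        - w2 * (p ^ 2 * a1 + q ^ 2 * b1 + r ^ 2 * c1)
        + w1 * (p ^ 2 * a2 + q ^ 2 * b2 + r ^ 2 * c2) by
    linear_combination p * (a1 * ha2 - a2 * ha1) + q * (b1 * hb2 - b2 * hb1)
      + r * (c1 * hc2 - c2 * hc1)
  rw [hm1, hm2] at hJ
  have hS : ((1 + p ^ 2) * (a1 ^ 2 + a2 ^ 2) + (1 + q ^ 2) * (b1 ^ 2 + b2 ^ 2)
      + (1 + r ^ 2) * (c1 ^ 2 + c2 ^ 2)) * (1 - e ^ 2) = (1 + e ^ 2) *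
      (u1 * (a1 + b1 + c1) + u2 * (a2 + b2 + c2)
        - w1 * (p * a1 + q * b1 + r * c1) - w2 * (p * a2 + q * b2 + r * c2))
      - 2 * e * (u2 * (a1 + b1 + c1) - u1 * (a2 + b2 + c2)
        - w2 * (p * a1 + q * b1 + r * c1) + w1 * (p * a2 + q * b2 + r * c2))
      - 2 * (u2 * (p * a1 + q * b1 + r * c1) - u1 * (p * a2 + q * b2 + r * c2)
        - w2 * (-(a1 + b1 + c1) + e * w1 + 2 * w2 - u1)
        + w1 * (-(a2 + b2 + c2) + e * w2 - 2 * w1 - u2)) := by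
    linear_combination (1 + e ^ 2) * hR - 2 * e * hI - 2 * hJ
  rw [sub_mul, hS]
  clear hS hR hI hJ hm1 hm2 ha1 ha2 hb1 hb2 hc1 hc2
  generalize hx : a1 + b1 + c1 = x at *
  generalize hy : a2 + b2 + c2 = y at *
  generalize hz : p * a1 + q * b1 + r * c1 = z at *
  generalize hv : p * a2 + q * b2 + r * c2 = v at *
  subst hw1 hw2 hu1 hu2
  ring

open Complex in
lemma triple_det_of_ne {p q r : ℝ} {a b c : ℂ}
    (h1 : (1 - I * q) * (1 + I * r) * b + (1 + I * q) * (1 - I * r) * c = p * (2 * I - q - r) * a)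
    (h2 : (1 - I * r) * (1 + I * p) * c + (1 + I * r) * (1 - I * p) * a = q * (2 * I - r - p) * b)
    (h3 : (1 - I * p) * (1 + I * q) * a + (1 + I * p) * (1 - I * q) * b = r * (2 * I - p - q) * c)
    {e1 e2 e3 : ℝ} (he1 : e1 = p + q + r) (he2 : e2 = p * q + q * r + r * p)
    (he3 : e3 = p * q * r) (hne : ¬(a = 0 ∧ b = 0 ∧ c = 0)) :
    2 + 6 * e2 - 2 * e1 ^ 2 - e1 ^ 2 * e2 - e1 * e3 + 4 * e3 ^ 2 = 0 ∧
      2 * e1 + 9 * e1 * e2 - 2 * e1 ^ 3 - e1 * e2 ^ 2 - 7 * e3 + 3 * e2 * e3 = 0 := by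
  by_cases ha : a = 0
  · by_cases hb : b = 0
    · have hc : c ≠ 0 := fun hc => hne ⟨ha, hb, hc⟩
      exact triple_det h3 h1 h2 (by rw [he1]; ring) (by rw [he2]; ring) (by rw [he3]; ring) hc
    · exact triple_det h2 h3 h1 (by rw [he1]; ring) (by rw [he2]; ring) (by rw [he3]; ring) hb
  · exact triple_det h1 h2 h3 he1 he2 he3 ha

/-- The value of the quadratic form controlling the triple inequality on the null vector. -/
lemma triple_T_pos {e1 e2 e3 : ℝ} (hE : e1 ^ 2 < 1)
    (hR : 2 + 6 * e2 - 2 * e1 ^ 2 - e1 ^ 2 * e2 - e1 * e3 + 4 * e3 ^ 2 = 0)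
    (hJ : 2 * e1 + 9 * e1 * e2 - 2 * e1 ^ 3 - e1 * e2 ^ 2 - 7 * e3 + 3 * e2 * e3 = 0) :
    0 < (2 * e2 - 1) ^ 2 + (3 * e1 - 2 * e3) ^ 2
      + e1 * ((-e1 - e1 * e2 + e3) * (2 * e2 - 1) + (1 + 2 * e2 + 2 * e1 ^ 2) * (3 * e1 - 2 * e3))
      + 3 * ((1 + 2 * e2 + 2 * e1 ^ 2) * (2 * e2 - 1) - (-e1 - e1 * e2 + e3) * (3 * e1 - 2 * e3))
      - 2 * ((-e1 - e1 * e2 + e3) ^ 2 + (1 + 2 * e2 + 2 * e1 ^ 2) ^ 2) := by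
  rcases eq_or_ne e1 0 with rfl | h0
  · have h : e3 * (3 * e2 - 7) = 0 := by linarith
    rcases mul_eq_zero.1 h with rfl | h
    · obtain rfl : e2 = -1 / 3 := by linarith
      norm_num
    · nlinarith [sq_nonneg e3]
  obtain ⟨g, rfl⟩ : ∃ g, e3 = g * e1 := ⟨e3 / e1, by field_simp⟩
  have hI : 2 * e1 ^ 2 = 2 + 9 * e2 - e2 ^ 2 + (3 * e2 - 7) * g := by
    apply mul_left_cancel₀ h0; linear_combination -hJ
  have hR' : 2 + 6 * e2 + e1 ^ 2 * (4 * g ^ 2 - g - 2 - e2) = 0 := by linear_combination hR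
  have := curve_T_pos (sq_nonneg e1) hE hI hR'
  convert this using 1
  ring

lemma triple_sum_sq_le_one {p q r : ℝ} {e1 e2 e3 : ℝ} (he1 : e1 = p + q + r)
    (he2 : e2 = p * q + q * r + r * p) (he3 : e3 = p * q * r)
    (hR : 2 + 6 * e2 - 2 * e1 ^ 2 - e1 ^ 2 * e2 - e1 * e3 + 4 * e3 ^ 2 = 0)
    (hJ : 2 * e1 + 9 * e1 * e2 - 2 * e1 ^ 3 - e1 * e2 ^ 2 - 7 * e3 + 3 * e2 * e3 = 0) :
    e1 ^ 2 ≤ 1 := by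
  by_contra! hE
  have h0 : e1 ≠ 0 := by rintro rfl; norm_num at hE
  have h3 : 3 * e2 ≤ e1 ^ 2 := by
    rw [he1, he2]; nlinarith [sq_nonneg (p - q), sq_nonneg (q - r), sq_nonneg (r - p)]
  have h4 : 3 * (e1 * e3) ≤ e2 ^ 2 := by
    rw [he1, he2, he3]
    nlinarith [sq_nonneg (p * q - q * r), sq_nonneg (q * r - r * p), sq_nonneg (r * p - p * q)]
  have h5 : 0 ≤ e1 ^ 2 * e2 ^ 2 - 4 * e2 ^ 3 - 4 * e1 ^ 3 * e3 + 18 * e1 * e2 * e3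
      - 27 * e3 ^ 2 := by
    have : e1 ^ 2 * e2 ^ 2 - 4 * e2 ^ 3 - 4 * e1 ^ 3 * e3 + 18 * e1 * e2 * e3
      - 27 * e3 ^ 2 = ((p - q) * (q - r) * (r - p)) ^ 2 := by rw [he1, he2, he3]; ring
    rw [this]; positivity
  clear he1 he2 he3
  obtain ⟨g, rfl⟩ : ∃ g, e3 = g * e1 := ⟨e3 / e1, by field_simp⟩
  have hI : 2 * e1 ^ 2 = 2 + 9 * e2 - e2 ^ 2 + (3 * e2 - 7) * g := by
    apply mul_left_cancel₀ h0; linear_combination -hJ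
  have hR' : 2 + 6 * e2 + e1 ^ 2 * (4 * g ^ 2 - g - 2 - e2) = 0 := by linear_combination hR
  have hg := curve_g_neg hE hI hR' h3 (by linarith)
  have hM := curve_M_pos hE hI hR' hg h3
  have hd := curve_disc_identity hI hR'
  have h6 : 0 < 8 * g ^ 2 + 18 * g + 65 := by nlinarith [sq_nonneg (8 * g + 9)]
  have h7 := mul_pos (sub_pos.2 hE) hM
  have h8 := mul_nonneg h5 h6.le
  linarith


/-- The solutions of the determinantal equations with `p + q + r = 1`. -/
lemma triple_roots_of_sum_one {p q r : ℝ} {e2 e3 : ℝ} (he1 : 1 = p + q + r)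
    (he2 : e2 = p * q + q * r + r * p) (he3 : e3 = p * q * r)
    (hR : 2 + 6 * e2 - 2 * 1 ^ 2 - 1 ^ 2 * e2 - 1 * e3 + 4 * e3 ^ 2 = 0)
    (hJ : 2 * 1 + 9 * 1 * e2 - 2 * 1 ^ 3 - 1 * e2 ^ 2 - 7 * e3 + 3 * e2 * e3 = 0) :
    (p = 0 ∧ q = 0 ∧ r = 1 ∨ q = 0 ∧ r = 0 ∧ p = 1 ∨ r = 0 ∧ p = 0 ∧ q = 1) ∨
      (p = -1 ∧ q = 1 ∧ r = 1 ∨ q = -1 ∧ r = 1 ∧ p = 1 ∨ r = -1 ∧ p = 1 ∧ q = 1) := by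
  have hy : e2 = (e3 - 4 * e3 ^ 2) / 5 := by linarith
  have h0 : e3 * ((e3 + 1) * (8 * e3 ^ 2 + 18 * e3 + 65)) = 0 := by
    rw [hy] at hJ
    linear_combination (-25 / 2) * hJ
  have hp : p ^ 3 - p ^ 2 + e2 * p - e3 = 0 := by
    rw [he2, he3]; linear_combination (-p ^ 2) * he1
  have hq : q ^ 3 - q ^ 2 + e2 * q - e3 = 0 := by
    rw [he2, he3]; linear_combination (-q ^ 2) * he1
  have hr : r ^ 3 - r ^ 2 + e2 * r - e3 = 0 := by
    rw [he2, he3]; linear_combination (-r ^ 2) * he1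
  rcases mul_eq_zero.1 h0 with h | h
  · have h2 : e2 = 0 := by rw [hy, h]; norm_num
    rw [h2, h] at hp hq hr
    have root : ∀ x : ℝ, x ^ 3 - x ^ 2 + 0 * x - 0 = 0 → x = 0 ∨ x = 1 := fun x hx => by
      have : x ^ 2 * (x - 1) = 0 := by linear_combination hx
      rcases mul_eq_zero.1 this with h | h
      · exact Or.inl (pow_eq_zero_iff two_ne_zero |>.1 h)
      · exact Or.inr (by linarith)
    left
    rcases root p hp with rfl | rfl <;> rcases root q hq with rfl | rfl <;>
      rcases root r hr with rfl | rfl <;>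
        first | (exfalso; norm_num at he1; done) | norm_num
  · rcases mul_eq_zero.1 h with h | h
    · obtain h : e3 = -1 := by linarith
      have h2 : e2 = -1 := by rw [hy, h]; norm_num
      rw [h2, h] at hp hq hr
      have root : ∀ x : ℝ, x ^ 3 - x ^ 2 + -1 * x - -1 = 0 → x = -1 ∨ x = 1 := fun x hx => by
        have : (x - 1) ^ 2 * (x + 1) = 0 := by linear_combination hx
        rcases mul_eq_zero.1 this with h | h
        · exact Or.inr (by linarith [pow_eq_zero_iff two_ne_zero |>.1 h])
        · exact Or.inl (by linarith)
      right
      rcases root p hp with rfl | rfl <;> rcases root q hq with rfl | rfl <;>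
        rcases root r hr with rfl | rfl <;>
        first | (exfalso; norm_num at he1; done) | norm_num
    · nlinarith [sq_nonneg (8 * e3 + 9)]

open Complex in
lemma triple_strict_zero_zero_one {a b c : ℂ}
    (h1 : (1 - I * (0 : ℝ)) * (1 + I * (1 : ℝ)) * b + (1 + I * (0 : ℝ)) * (1 - I * (1 : ℝ)) * c
      = (0 : ℝ) * (2 * I - (0 : ℝ) - (1 : ℝ)) * a)
    (h2 : (1 - I * (1 : ℝ)) * (1 + I * (0 : ℝ)) * c + (1 + I * (1 : ℝ)) * (1 - I * (0 : ℝ)) * a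
      = (0 : ℝ) * (2 * I - (1 : ℝ) - (0 : ℝ)) * b)
    (hne : ¬(a = 0 ∧ b = 0 ∧ c = 0)) :
    normSq ((1 - I * (0 : ℝ)) * a + (1 - I * (0 : ℝ)) * b + (1 - I * (1 : ℝ)) * c) <
      (1 + (0 : ℝ) ^ 2) * normSq a + (1 + (0 : ℝ) ^ 2) * normSq b
        + (1 + (1 : ℝ) ^ 2) * normSq c := by
  have hI : I ^ 2 = -1 := I_sq
  push_cast at *
  obtain rfl : b = I * c := by linear_combination (1 - I) / 2 * h1 + ((b - I * c) / 2 + (I - 1) / 2 * c) * hI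
  obtain rfl : a = I * c := by linear_combination (1 - I) / 2 * h2 + ((a - I * c) / 2 + (I - 1) / 2 * c) * hI
  have hc : 0 < normSq c := normSq_pos.2 fun h => hne (by simp [h])
  have h3 : (1 - I * 0) * (I * c) + (1 - I * 0) * (I * c) + (1 - I * 1) * c = (1 + I) * c := by ring
  have h4 : normSq (1 + I) = 2 := by norm_num [normSq_apply]
  rw [h3, normSq_mul, normSq_mul, h4, normSq_I]
  linarith

open Complex in
lemma triple_strict_neg_one_one {a b c : ℂ}
    (h1 : (1 - I * (1 : ℝ)) * (1 + I * (1 : ℝ)) * b + (1 + I * (1 : ℝ)) * (1 - I * (1 : ℝ)) * c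
      = (-1 : ℝ) * (2 * I - (1 : ℝ) - (1 : ℝ)) * a)
    (hne : ¬(a = 0 ∧ b = 0 ∧ c = 0)) :
    normSq ((1 - I * (-1 : ℝ)) * a + (1 - I * (1 : ℝ)) * b + (1 - I * (1 : ℝ)) * c) <
      (1 + (-1 : ℝ) ^ 2) * normSq a + (1 + (1 : ℝ) ^ 2) * normSq b
        + (1 + (1 : ℝ) ^ 2) * normSq c := by
  have hI : I ^ 2 = -1 := I_sq
  push_cast at *
  obtain rfl : c = (1 - I) * a - b := by linear_combination (1 / 2) * h1 + (b + c) / 2 * hI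
  have h3 : (1 - I * -1) * a + (1 - I * 1) * b + (1 - I * 1) * ((1 - I) * a - b)
      = (1 - I) * a := by linear_combination a * hI
  have h4 : normSq (1 - I) = 2 := by norm_num [normSq_apply]
  rw [h3, normSq_mul, h4]
  have hb := normSq_nonneg b
  have hc := normSq_nonneg ((1 - I) * a - b)
  have : 0 < normSq b + normSq ((1 - I) * a - b) := by
    by_contra! h
    have hb0 : b = 0 := normSq_eq_zero.1 (by linarith)
    have hc0 : (1 - I) * a - b = 0 := normSq_eq_zero.1 (by linarith)
    have ha0 : a = 0 := by
      have : (1 - I) * a = 0 := by rwa [hb0, sub_zero] at hc0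
      rcases mul_eq_zero.1 this with h | h
      · rw [h] at h4; norm_num at h4
      · exact h
    exact hne ⟨ha0, hb0, hc0⟩
  linarith

open Complex in
lemma triple_strict_of_sum_one {p q r : ℝ} {a b c : ℂ}
    (h1 : (1 - I * q) * (1 + I * r) * b + (1 + I * q) * (1 - I * r) * c = p * (2 * I - q - r) * a)
    (h2 : (1 - I * r) * (1 + I * p) * c + (1 + I * r) * (1 - I * p) * a = q * (2 * I - r - p) * b)
    (h3 : (1 - I * p) * (1 + I * q) * a + (1 + I * p) * (1 - I * q) * b = r * (2 * I - p - q) * c)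
    (he : 1 = p + q + r) (hne : ¬(a = 0 ∧ b = 0 ∧ c = 0)) :
    normSq ((1 - I * p) * a + (1 - I * q) * b + (1 - I * r) * c) <
      (1 + p ^ 2) * normSq a + (1 + q ^ 2) * normSq b + (1 + r ^ 2) * normSq c := by
  obtain ⟨hR, hJ⟩ := triple_det_of_ne h1 h2 h3 he rfl rfl hne
  rcases triple_roots_of_sum_one he rfl rfl hR hJ with
    (⟨rfl, rfl, rfl⟩ | ⟨rfl, rfl, rfl⟩ | ⟨rfl, rfl, rfl⟩) |
    (⟨rfl, rfl, rfl⟩ | ⟨rfl, rfl, rfl⟩ | ⟨rfl, rfl, rfl⟩)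
  · exact triple_strict_zero_zero_one h1 h2 hne
  · have := triple_strict_zero_zero_one h2 h3 (fun h => hne ⟨h.2.2, h.1, h.2.1⟩)
    convert this using 1
    · congr 1; ring
    · ring
  · have := triple_strict_zero_zero_one h3 h1 (fun h => hne ⟨h.2.1, h.2.2, h.1⟩)
    convert this using 1
    · congr 1; ring
    · ring
  · exact triple_strict_neg_one_one h1 hne
  · have := triple_strict_neg_one_one h2 (fun h => hne ⟨h.2.2, h.1, h.2.1⟩)
    convert this using 1
    · congr 1; ring
    · ring
  · have := triple_strict_neg_one_one h3 (fun h => hne ⟨h.2.1, h.2.2, h.1⟩)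
    convert this using 1
    · congr 1; ring
    · ring

open Complex in
lemma weighted_normSq_pos (p q r : ℝ) {a b c : ℂ} (hne : ¬(a = 0 ∧ b = 0 ∧ c = 0)) :
    0 < (1 + p ^ 2) * normSq a + (1 + q ^ 2) * normSq b + (1 + r ^ 2) * normSq c := by
  have nonneg : ∀ (x : ℝ) (z : ℂ), 0 ≤ (1 + x ^ 2) * normSq z := fun x z =>
    mul_nonneg (by positivity) (normSq_nonneg z)
  have eq_zero : ∀ (x : ℝ) (z : ℂ), (1 + x ^ 2) * normSq z ≤ 0 → z = 0 := fun x z h => by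
    have := (mul_eq_zero.1 (le_antisymm h (nonneg x z))).resolve_left (by positivity)
    exact normSq_eq_zero.1 this
  have ha := nonneg p a
  have hb := nonneg q b
  have hc := nonneg r c
  by_contra! h
  exact hne ⟨eq_zero p a (by linarith), eq_zero q b (by linarith), eq_zero r c (by linarith)⟩

set_option maxHeartbeats 800000 in
open Complex in
lemma triple_strict_of_sum_lt_one {p q r : ℝ} {a b c : ℂ}
    (h1 : (1 - I * q) * (1 + I * r) * b + (1 + I * q) * (1 - I * r) * c = p * (2 * I - q - r) * a)
    (h2 : (1 - I * r) * (1 + I * p) * c + (1 + I * r) * (1 - I * p) * a = q * (2 * I - r - p) * b)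
    (h3 : (1 - I * p) * (1 + I * q) * a + (1 + I * p) * (1 - I * q) * b = r * (2 * I - p - q) * c)
    {e1 : ℝ} (he1 : e1 = p + q + r) (hE : e1 ^ 2 < 1) (hne : ¬(a = 0 ∧ b = 0 ∧ c = 0)) :
    normSq ((1 - I * p) * a + (1 - I * q) * b + (1 - I * r) * c) <
      (1 + p ^ 2) * normSq a + (1 + q ^ 2) * normSq b + (1 + r ^ 2) * normSq c := by
  obtain ⟨e2, he2⟩ : ∃ e2, e2 = p * q + q * r + r * p := ⟨_, rfl⟩
  obtain ⟨e3, he3⟩ : ∃ e3, e3 = p * q * r := ⟨_, rfl⟩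
  obtain ⟨hR, hJ⟩ := triple_det_of_ne h1 h2 h3 he1 he2 he3 hne
  have hT := triple_T_pos hE hR hJ
  have hI : I ^ 2 = -1 := I_sq
  have he1' : (e1 : ℂ) = p + q + r := by rw [he1]; push_cast; ring
  have he2' : (e2 : ℂ) = p * q + q * r + r * p := by rw [he2]; push_cast; ring
  have he3' : (e3 : ℂ) = p * q * r := by rw [he3]; push_cast; ring
  obtain ⟨m0, hm0⟩ : ∃ m, m = a + b + c := ⟨_, rfl⟩
  obtain ⟨m1, hm1⟩ : ∃ m, m = p * a + q * b + r * c := ⟨_, rfl⟩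
  obtain ⟨A1, hA1⟩ : ∃ A, A = m1 + I * m0 := ⟨_, rfl⟩
  obtain ⟨A0, hA0⟩ : ∃ A, A = I / 2 * (e1 * m0 + m1) := ⟨_, rfl⟩
  have hσ : (1 - I * p) * a + (1 - I * q) * b + (1 - I * r) * c = -I * A1 := by
    rw [hA1, hm0, hm1]; linear_combination (a + b + c) * hI
  have hI3 : I ^ 3 = -I := by rw [pow_succ, hI]; ring
  have hm2 : (p : ℂ) * p * a + q * q * b + r * r * c = -m0 + (e1 - 2 * I) * A1 - A0 := by
    rw [hA0, hA1, hm0, hm1, he1']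
    linear_combination (norm := skip) (-1 / 2) * (h1 + h2 + h3)
    ring_nf
    simp only [hI]
    ring
  have ha : (1 + I * e1 - I * p - p * p) * a = A0 - A1 * p := by
    rw [hA0, hA1, hm0, hm1, he1']
    linear_combination (norm := skip) -h1 + (1 / 2) * (h1 + h2 + h3)
    ring_nf
    simp only [hI]
    ring
  have hb : (1 + I * e1 - I * q - q * q) * b = A0 - A1 * q := by
    rw [hA0, hA1, hm0, hm1, he1']
    linear_combination (norm := skip) -h2 + (1 / 2) * (h1 + h2 + h3)
    ring_nf
    simp only [hI]
    ring
  have hc : (1 + I * e1 - I * r - r * r) * c = A0 - A1 * r := by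
    rw [hA0, hA1, hm0, hm1, he1']
    linear_combination (norm := skip) -h3 + (1 / 2) * (h1 + h2 + h3)
    ring_nf
    simp only [hI]
    ring
  have hlin : (2 + 4 * e2 - I * (e1 + 2 * e3)) * m0 = (4 * e1 + I * (3 + 2 * e2)) * m1 := by
    rw [hm0, hm1, he1', he2', he3']
    linear_combination (norm := skip) -2 * I * (p * h1 + q * h2 + r * h3) + (h1 + h2 + h3)
    ring_nf
    simp only [hI, hI3]
    ring
  obtain ⟨t, ht0, ht1⟩ : ∃ t : ℂ, m0 = t * (4 * e1 + I * (3 + 2 * e2)) ∧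
      m1 = t * (2 + 4 * e2 - I * (e1 + 2 * e3)) := by
    by_cases hα : (2 + 4 * e2 - I * (e1 + 2 * e3) : ℂ) = 0
    · have hβ : (4 * e1 + I * (3 + 2 * e2) : ℂ) ≠ 0 := by
        intro hβ
        have h5 := congr_arg re hα
        have h6 := congr_arg im hβ
        simp at h5 h6
        linarith
      refine ⟨m0 / (4 * e1 + I * (3 + 2 * e2)), by field_simp, ?_⟩
      rw [hα, zero_mul] at hlin
      rw [hα, mul_zero]
      exact (mul_eq_zero.1 hlin.symm).resolve_left hβ
    · refine ⟨m1 / (2 + 4 * e2 - I * (e1 + 2 * e3)), ?_, by field_simp⟩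
      field_simp
      linear_combination hlin
  have hA1' : A1 = t * (2 * e2 - 1 + I * (3 * e1 - 2 * e3)) := by
    rw [hA1, ht0, ht1]
    linear_combination t * (3 + 2 * e2) * hI
  have hA0' : A0 = t * (-e1 - e1 * e2 + e3 + I * (1 + 2 * e2 + 2 * e1 * e1)) := by
    rw [hA0, ht0, ht1]
    linear_combination t * (-(e1 + 2 * e3) / 2 + e1 * (3 + 2 * e2) / 2) * hI
  have key := triple_norm_identity_real (p := p) (q := q) (r := r) (e := e1)
    (a1 := a.re) (a2 := a.im) (b1 := b.re) (b2 := b.im) (c1 := c.re) (c2 := c.im)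
    (u1 := A0.re) (u2 := A0.im) (w1 := A1.re) (w2 := A1.im)
    (by have := congr_arg re ha; simp at this; linear_combination this)
    (by have := congr_arg im ha; simp at this; linear_combination this)
    (by have := congr_arg re hb; simp at this; linear_combination this)
    (by have := congr_arg im hb; simp at this; linear_combination this)
    (by have := congr_arg re hc; simp at this; linear_combination this)
    (by have := congr_arg im hc; simp at this; linear_combination this)
    (by rw [hA1, hm0, hm1]; simp; ring)
    (by rw [hA1, hm0, hm1]; simp)
    (by rw [hA0, hm0, hm1]; simp; ring)
    (by rw [hA0, hm0, hm1]; simp; ring)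
    (by have := congr_arg re hm2; rw [hm0] at this; simp at this; linear_combination this)
    (by have := congr_arg im hm2; rw [hm0] at this; simp at this; linear_combination this)
  rw [hσ, normSq_mul, normSq_neg, normSq_I, one_mul]
  by_cases ht : t = 0
  · rw [hA1', ht, zero_mul, normSq_zero]
    exact weighted_normSq_pos p q r hne
  · have ht' : 0 < normSq t := normSq_pos.2 ht
    have w1 : A1.re = t.re * (2 * e2 - 1) - t.im * (3 * e1 - 2 * e3) := by rw [hA1']; simp
    have w2 : A1.im = t.re * (3 * e1 - 2 * e3) + t.im * (2 * e2 - 1) := by rw [hA1']; simp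
    have u1 : A0.re = t.re * (-e1 - e1 * e2 + e3) - t.im * (1 + 2 * e2 + 2 * e1 * e1) := by
      rw [hA0']; simp
    have u2 : A0.im = t.re * (1 + 2 * e2 + 2 * e1 * e1) + t.im * (-e1 - e1 * e2 + e3) := by
      rw [hA0']; simp
    have hpos : 0 < ((1 + p ^ 2) * normSq a + (1 + q ^ 2) * normSq b + (1 + r ^ 2) * normSq c
        - normSq A1) * (1 - e1 ^ 2) := by
      have h4 := mul_pos ht' hT
      rw [u1, u2] at key
      simp only [normSq_apply] at h4 ⊢
      rw [w1, w2] at key ⊢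
      linear_combination h4 - key
    linarith [(mul_pos_iff_of_pos_right (sub_pos.2 hE)).1 hpos]

open Complex in
/-- If `a`, `b`, `c` solve the cyclic linear system of a spectral triple, then
`|ξ + η + ζ|² < |ξ|² + |η|² + |ζ|²` for the normalised unknowns, unless they all vanish. -/
lemma triple_strict {p q r : ℝ} {a b c : ℂ}
    (h1 : (1 - I * q) * (1 + I * r) * b + (1 + I * q) * (1 - I * r) * c = p * (2 * I - q - r) * a)
    (h2 : (1 - I * r) * (1 + I * p) * c + (1 + I * r) * (1 - I * p) * a = q * (2 * I - r - p) * b)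
    (h3 : (1 - I * p) * (1 + I * q) * a + (1 + I * p) * (1 - I * q) * b = r * (2 * I - p - q) * c)
    (hne : ¬(a = 0 ∧ b = 0 ∧ c = 0)) :
    normSq ((1 - I * p) * a + (1 - I * q) * b + (1 - I * r) * c) <
      (1 + p ^ 2) * normSq a + (1 + q ^ 2) * normSq b + (1 + r ^ 2) * normSq c := by
  obtain ⟨hR, hJ⟩ := triple_det_of_ne h1 h2 h3 rfl rfl rfl hne
  rcases (triple_sum_sq_le_one rfl rfl rfl hR hJ).lt_or_eq with h | h
  · exact triple_strict_of_sum_lt_one h1 h2 h3 rfl h hne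
  rcases (sq_eq_sq_iff_eq_or_eq_neg.1 (h.trans (one_pow 2).symm)) with h | h
  · exact triple_strict_of_sum_one h1 h2 h3 h.symm hne
  · have conj_row : ∀ {p q r : ℝ} {a b c : ℂ}, (1 - I * q) * (1 + I * r) * b
        + (1 + I * q) * (1 - I * r) * c = p * (2 * I - q - r) * a →
        (1 - I * (-q : ℝ)) * (1 + I * (-r : ℝ)) * (starRingEnd ℂ) b
        + (1 + I * (-q : ℝ)) * (1 - I * (-r : ℝ)) * (starRingEnd ℂ) c
        = (-p : ℝ) * (2 * I - (-q : ℝ) - (-r : ℝ)) * (starRingEnd ℂ) a := by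
      intro p q r a b c h
      have := congr_arg (starRingEnd ℂ) h
      simp only [map_add, map_mul, map_sub, map_one, conj_I, conj_ofReal, map_ofNat] at this
      push_cast
      linear_combination this
    have := triple_strict_of_sum_one (conj_row h1) (conj_row h2) (conj_row h3) (by linarith)
      (fun h => hne (by simpa using h))
    simp only [normSq_conj, neg_sq] at this
    convert this using 1
    rw [← normSq_conj]
    simp [sub_eq_add_neg]

open Complex in
/-- Cayley parametrization of the unit circle without `1`. -/
lemma exists_cayley_param {l m : ℂ} (hm : m = (starRingEnd ℂ) l) (hl : m * l = 1) (h1 : l ≠ 1) :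
    ∃ p : ℝ, l * (1 - I * p) = -(1 + I * p) ∧ m * (1 + I * p) = -(1 - I * p) ∧
      (1 - I * p : ℂ) ≠ 0 := by
  have hn : l.re * l.re + l.im * l.im = 1 := by
    have := congrArg re hl
    rw [hm] at this
    simpa using this
  have hx : 1 - l.re ≠ 0 := fun h => by
    have h2 : l.re = 1 := by linarith
    have h3 : l.im = 0 := by
      rw [h2] at hn
      exact mul_self_eq_zero.1 (by linarith)
    exact h1 (Complex.ext h2 h3)
  obtain ⟨p, hp⟩ : ∃ p : ℝ, p * (1 - l.re) = -l.im := ⟨-l.im / (1 - l.re), div_mul_cancel₀ _ hx⟩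
  have key : l * (1 - I * p) = -(1 + I * p) := by
    apply Complex.ext
    · simp
      refine mul_left_cancel₀ hx ?_
      linear_combination l.im * hp - hn
    · simp
      linear_combination hp
  refine ⟨p, key, ?_, fun h => ?_⟩
  · have := congrArg (starRingEnd ℂ) key
    simpa [← hm, ← sub_eq_add_neg] using this
  · have := congrArg re h
    simp at this

open Complex in
lemma cayley_row {p q r : ℝ} {l m₂ m₃ a b c : ℂ} (hl : l * (1 - I * p) = -(1 + I * p))
    (h2 : m₂ * (1 + I * q) = -(1 - I * q)) (h3 : m₃ * (1 + I * r) = -(1 - I * r))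
    (h : (1 + l) * (2 - m₂ - m₃) * ((1 - I * p) * a)
      + 2 * ((1 - m₂) * ((1 - I * q) * b) + (1 - m₃) * ((1 - I * r) * c)) = 0) :
    (1 - I * q) * (1 + I * r) * b + (1 + I * q) * (1 - I * r) * c
      = p * (2 * I - q - r) * a := by
  linear_combination (1 / 4) * (1 + I * q) * (1 + I * r) * h
    - (1 / 4) * a * ((1 - m₂) * (1 + I * q) * (1 + I * r) + (1 - m₃) * (1 + I * q) * (1 + I * r)) * hl
    + (1 / 4) * ((-2 * I * p) * a * (1 + I * r) + 2 * (1 + I * r) * (1 - I * q) * b) * h2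
    + (1 / 4) * ((-2 * I * p) * a * (1 + I * q) + 2 * (1 + I * q) * (1 - I * r) * c) * h3
    + p * (q + r) * a * I_sq

/-- The rows vanish on triples of unit numbers containing `1`, under the resonance conditions. -/
lemma rows_eq_zero_of_eq_one {l₂ l₃ m₂ m₃ x y z : ℂ} (hm₂ : m₂ = (starRingEnd ℂ) l₂)
    (hm₃ : m₃ = (starRingEnd ℂ) l₃) (h₂ : m₂ * l₂ = 1) (h₃ : m₃ * l₃ = 1)
    (r₁ : 2 * (2 - m₂ - m₃) * x + 2 * ((1 - m₂) * y + (1 - m₃) * z) = 0)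
    (r₂ : (1 + l₂) * (1 - m₃) * y + 2 * ((1 - m₃) * z) = 0)
    (r₃ : (1 + l₃) * (1 - m₂) * z + 2 * ((1 - m₂) * y) = 0)
    (hl₂ : l₂ = 1 → z = 0) (hl₃ : l₃ = 1 → y = 0) (hx : l₂ = 1 → l₃ = 1 → x = 0) :
    x = 0 ∧ y = 0 ∧ z = 0 := by
  have one : ∀ {l m : ℂ}, m * l = 1 → 1 - m = 0 → l = 1 := fun h h' => by
    rw [← sub_eq_zero.1 h', one_mul] at h; exact h
  by_cases e₂ : l₂ = 1
  · have hz := hl₂ e₂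
    have hm : m₂ = 1 := by rw [hm₂, e₂, map_one]
    subst hz e₂ hm
    by_cases e₃ : l₃ = 1
    · exact ⟨hx rfl e₃, hl₃ e₃, rfl⟩
    · have h0 : 1 - m₃ ≠ 0 := fun h => e₃ (one h₃ h)
      refine ⟨mul_left_cancel₀ h0 ?_, mul_left_cancel₀ h0 ?_, rfl⟩
      · linear_combination r₁ / 2
      · linear_combination r₂ / 2
  by_cases e₃ : l₃ = 1
  · have hy := hl₃ e₃
    have hm : m₃ = 1 := by rw [hm₃, e₃, map_one]
    subst hy e₃ hm
    have h0 : 1 - m₂ ≠ 0 := fun h => e₂ (one h₂ h)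
    refine ⟨mul_left_cancel₀ h0 ?_, rfl, mul_left_cancel₀ h0 ?_⟩
    · linear_combination r₁ / 2
    · linear_combination r₃ / 2
  have h02 : 1 - m₂ ≠ 0 := fun h => e₂ (one h₂ h)
  have h03 : 1 - m₃ ≠ 0 := fun h => e₃ (one h₃ h)
  have s₂ : (1 + l₂) * y + 2 * z = 0 := mul_left_cancel₀ h03 (by linear_combination r₂)
  have s₃ : (1 + l₃) * z + 2 * y = 0 := mul_left_cancel₀ h02 (by linear_combination r₃)
  have unit : ∀ {l m : ℂ}, m = (starRingEnd ℂ) l → m * l = 1 → l ≠ 1 →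
      l.re * l.re + l.im * l.im = 1 ∧ l.re < 1 := fun {l m} hm h hl => by
    have hn : l.re * l.re + l.im * l.im = 1 := by
      have := congrArg Complex.re h
      rw [hm] at this
      simpa using this
    refine ⟨hn, lt_of_le_of_ne (by nlinarith [mul_self_nonneg l.im]) fun h2 => hl ?_⟩
    rw [h2] at hn
    exact Complex.ext h2 (mul_self_eq_zero.1 (by linarith))
  obtain ⟨n₂, u₂⟩ := unit hm₂ h₂ e₂
  obtain ⟨n₃, u₃⟩ := unit hm₃ h₃ e₃
  have hy : y = 0 := by
    have h : ((1 + l₂) * (1 + l₃) - 4) * y = 0 := by linear_combination (1 + l₃) * s₂ - 2 * s₃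
    refine (mul_eq_zero.1 h).resolve_left fun h => ?_
    have h4 : (1 + l₂) * (1 + l₃) = 4 := by linear_combination h
    have h5 := congrArg Complex.normSq h4
    rw [map_mul] at h5
    have k₂ : Complex.normSq (1 + l₂) = 2 + 2 * l₂.re := by
      rw [Complex.normSq_apply]; simp; linear_combination n₂
    have k₃ : Complex.normSq (1 + l₃) = 2 + 2 * l₃.re := by
      rw [Complex.normSq_apply]; simp; linear_combination n₃
    have k₄ : Complex.normSq (4 : ℂ) = 16 := by
      rw [Complex.normSq_apply]; norm_num
    rw [k₂, k₃, k₄] at h5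
    nlinarith [mul_self_nonneg l₂.im, mul_self_nonneg l₃.im]
  have hz : z = 0 := by
    rw [hy] at s₂
    simpa using s₂
  refine ⟨?_, hy, hz⟩
  rw [hy, hz] at r₁
  have : (2 - m₂ - m₃) * x = 0 := by linear_combination r₁ / 2
  refine (mul_eq_zero.1 this).resolve_left fun h => ?_
  have := congrArg Complex.re h
  rw [hm₂, hm₃] at this
  simp at this
  linarith

/-- A triple of complex numbers solving the cyclic linear system attached to three unit numbers
`l₁, l₂, l₃`. -/
structure CyclicRows (l₁ l₂ l₃ x y z : ℂ) : Prop where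
  unit₁ : (starRingEnd ℂ) l₁ * l₁ = 1
  unit₂ : (starRingEnd ℂ) l₂ * l₂ = 1
  unit₃ : (starRingEnd ℂ) l₃ * l₃ = 1
  row₁ : (1 + l₁) * (2 - (starRingEnd ℂ) l₂ - (starRingEnd ℂ) l₃) * x
    + 2 * ((1 - (starRingEnd ℂ) l₂) * y + (1 - (starRingEnd ℂ) l₃) * z) = 0
  row₂ : (1 + l₂) * (2 - (starRingEnd ℂ) l₃ - (starRingEnd ℂ) l₁) * y
    + 2 * ((1 - (starRingEnd ℂ) l₃) * z + (1 - (starRingEnd ℂ) l₁) * x) = 0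
  row₃ : (1 + l₃) * (2 - (starRingEnd ℂ) l₁ - (starRingEnd ℂ) l₂) * z
    + 2 * ((1 - (starRingEnd ℂ) l₁) * x + (1 - (starRingEnd ℂ) l₂) * y) = 0

/-- The vanishing of the unknowns at resonant pairs. -/
structure CyclicResonance (l₁ l₂ l₃ x y z : ℂ) : Prop where
  res₁ : l₂ * l₃ = 1 → x = 0
  res₂ : l₃ * l₁ = 1 → y = 0
  res₃ : l₁ * l₂ = 1 → z = 0

section
variable {l₁ l₂ l₃ x y z : ℂ}

lemma CyclicRows.rotate (h : CyclicRows l₁ l₂ l₃ x y z) : CyclicRows l₂ l₃ l₁ y z x :=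
  ⟨h.unit₂, h.unit₃, h.unit₁, h.row₂, h.row₃, h.row₁⟩

lemma CyclicResonance.rotate (h : CyclicResonance l₁ l₂ l₃ x y z) :
    CyclicResonance l₂ l₃ l₁ y z x :=
  ⟨h.res₂, h.res₃, h.res₁⟩

lemma CyclicRows.eq_zero_of_left_eq_one (h : CyclicRows l₁ l₂ l₃ x y z)
    (hr : CyclicResonance l₁ l₂ l₃ x y z) (h1 : l₁ = 1) : x = 0 ∧ y = 0 ∧ z = 0 := by
  subst h1
  have r₁ := h.row₁
  have r₂ := h.row₂
  have r₃ := h.row₃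
  rw [map_one] at r₂ r₃
  exact rows_eq_zero_of_eq_one rfl rfl h.unit₂ h.unit₃ (by linear_combination r₁)
    (by linear_combination r₂) (by linear_combination r₃) (fun e => hr.res₃ (by rw [e, one_mul]))
    (fun e => hr.res₂ (by rw [e, one_mul])) (fun e e' => hr.res₁ (by rw [e, e', one_mul]))

lemma CyclicRows.eq_zero_of_eq_one (h : CyclicRows l₁ l₂ l₃ x y z)
    (hr : CyclicResonance l₁ l₂ l₃ x y z) (h1 : l₁ = 1 ∨ l₂ = 1 ∨ l₃ = 1) :
    x = 0 ∧ y = 0 ∧ z = 0 := by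
  rcases h1 with h1 | h1 | h1
  · exact h.eq_zero_of_left_eq_one hr h1
  · obtain ⟨a, b, c⟩ := h.rotate.eq_zero_of_left_eq_one hr.rotate h1
    exact ⟨c, a, b⟩
  · obtain ⟨a, b, c⟩ := h.rotate.rotate.eq_zero_of_left_eq_one hr.rotate.rotate h1
    exact ⟨b, c, a⟩

lemma CyclicRows.eq_zero_of_resonance (h : CyclicRows l₁ l₂ l₃ x y z)
    (hr : CyclicResonance l₁ l₂ l₃ x y z) (h23 : l₂ * l₃ = 1) : x = 0 ∧ y = 0 ∧ z = 0 := by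
  by_cases h1 : l₁ = 1 ∨ l₂ = 1 ∨ l₃ = 1
  · exact h.eq_zero_of_eq_one hr h1
  push Not at h1
  obtain ⟨-, h2, -⟩ := h1
  have hx := hr.res₁ h23
  have hl₂ : l₂ ≠ 0 := left_ne_zero_of_mul_eq_one h23
  have e₃ : l₃ = (starRingEnd ℂ) l₂ :=
    mul_left_cancel₀ hl₂ (h23.trans ((mul_comm _ _).trans h.unit₂).symm)
  have e₃' : (starRingEnd ℂ) l₃ = l₂ := by rw [e₃, Complex.conj_conj]
  have u₁ := h.unit₁
  have u₂ := h.unit₂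
  have r₁ := h.row₁
  have r₂ := h.row₂
  have r₃ := h.row₃
  rw [e₃', hx] at r₁ r₂
  rw [hx, e₃] at r₃
  set m := (starRingEnd ℂ) l₂ with hm
  set m₁ := (starRingEnd ℂ) l₁ with hm₁
  have hy : y = l₂ * z := by
    refine mul_left_cancel₀ (sub_ne_zero.2 h2) ?_
    linear_combination (l₂ / 2) * r₁ + y * u₂
  have hz : z = 0 := by
    by_contra hz
    have s₂ : (1 + l₂) * (2 - l₂ - m₁) * l₂ + 2 * (1 - l₂) = 0 := by
      refine mul_right_cancel₀ hz ?_
      rw [hy] at r₂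
      linear_combination r₂
    have s₃ : (l₂ + 1) * (2 - m₁ - m) + 2 * (l₂ - 1) * l₂ = 0 := by
      refine mul_right_cancel₀ hz ?_
      rw [hy] at r₃
      linear_combination l₂ * r₃ + (2 * l₂ * z - (2 - m₁ - m) * z) * u₂
    have s : 3 * l₂ ^ 2 + 2 * l₂ + 3 = 0 := by
      refine mul_left_cancel₀ (sub_ne_zero.2 h2) ?_
      linear_combination l₂ * s₃ - s₂ + (l₂ + 1) * u₂
    have hm1 : m₁ = -1 / 3 := by
      have h3 : l₂ * (1 + l₂) ≠ 0 := by
        refine mul_ne_zero hl₂ fun h3 => ?_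
        have : l₂ = -1 := by linear_combination h3
        rw [this] at s
        norm_num at s
      refine mul_left_cancel₀ h3 ?_
      linear_combination -s₂ + (-l₂/3 + 2/3) * s
    rw [hm₁] at hm1
    have : l₁ = -1 / 3 := by
      have := congrArg (starRingEnd ℂ) hm1
      simpa [map_ofNat] using this
    rw [← hm₁] at hm1
    rw [hm1, this] at u₁
    norm_num at u₁
  exact ⟨hx, by rw [hy, hz, mul_zero], hz⟩

lemma CyclicRows.eq_zero_or_normSq_lt (h : CyclicRows l₁ l₂ l₃ x y z)
    (hr : CyclicResonance l₁ l₂ l₃ x y z) : (x = 0 ∧ y = 0 ∧ z = 0) ∨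
      Complex.normSq (x + y + z) < Complex.normSq x + Complex.normSq y + Complex.normSq z := by
  by_cases h1 : l₁ = 1 ∨ l₂ = 1 ∨ l₃ = 1
  · exact Or.inl (h.eq_zero_of_eq_one hr h1)
  push Not at h1
  obtain ⟨p, p1, p2, p3⟩ := exists_cayley_param rfl h.unit₁ h1.1
  obtain ⟨q, q1, q2, q3⟩ := exists_cayley_param rfl h.unit₂ h1.2.1
  obtain ⟨r, r1, r2, r3⟩ := exists_cayley_param rfl h.unit₃ h1.2.2
  obtain ⟨a, rfl⟩ : ∃ a, x = (1 - Complex.I * p) * a := ⟨_, (mul_div_cancel₀ x p3).symm⟩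
  obtain ⟨b, rfl⟩ : ∃ b, y = (1 - Complex.I * q) * b := ⟨_, (mul_div_cancel₀ y q3).symm⟩
  obtain ⟨c, rfl⟩ : ∃ c, z = (1 - Complex.I * r) * c := ⟨_, (mul_div_cancel₀ z r3).symm⟩
  by_cases hne : a = 0 ∧ b = 0 ∧ c = 0
  · left
    simp [hne]
  right
  have := triple_strict (cayley_row p1 q2 r2 h.row₁) (cayley_row q1 r2 p2 h.row₂)
    (cayley_row r1 p2 q2 h.row₃) hne
  have hn : ∀ p : ℝ, Complex.normSq (1 - Complex.I * p) = 1 + p ^ 2 := fun p => by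
    simp [Complex.normSq_apply]; ring
  simpa only [map_mul, hn] using this

lemma CyclicRows.pow_twelve_eq_one (h : CyclicRows l₁ l₂ ((starRingEnd ℂ) l₂) x y z)
    (hx : x ≠ 0) : l₂ ^ 12 = 1 := by
  by_cases h2 : l₂ = 1
  · rw [h2, one_pow]
  have h3 : (starRingEnd ℂ) l₂ ≠ 1 := fun h => h2 (by simpa using congrArg (starRingEnd ℂ) h)
  by_cases h1 : l₁ = 1
  · subst h1
    have r₁ := h.row₁
    have r₂ := h.row₂
    have r₃ := h.row₃
    rw [map_one] at r₂ r₃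
    exact absurd (rows_eq_zero_of_eq_one (l₂ := l₂) (l₃ := (starRingEnd ℂ) l₂)
      (m₂ := (starRingEnd ℂ) l₂) (m₃ := (starRingEnd ℂ) ((starRingEnd ℂ) l₂)) (x := x) (y := y)
      (z := z) rfl rfl h.unit₂ h.unit₃ (by linear_combination r₁)
      (by linear_combination r₂) (by linear_combination r₃) (fun e => absurd e h2)
      (fun e => absurd e h3) (fun e => absurd e h2)).1 hx
  obtain ⟨p, p1, p2, p3⟩ := exists_cayley_param rfl h.unit₁ h1
  obtain ⟨q, q1, q2, q3⟩ := exists_cayley_param rfl h.unit₂ h2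
  have r1 : (starRingEnd ℂ) l₂ * (1 - Complex.I * (-q : ℝ)) = -(1 + Complex.I * (-q : ℝ)) := by
    push_cast; linear_combination q2
  have r2 : (starRingEnd ℂ) ((starRingEnd ℂ) l₂) * (1 + Complex.I * (-q : ℝ))
      = -(1 - Complex.I * (-q : ℝ)) := by
    rw [Complex.conj_conj]; push_cast; linear_combination q1
  have r3 : (1 - Complex.I * (-q : ℝ) : ℂ) ≠ 0 := fun h => by
    have := congrArg Complex.re h
    simp at this
  obtain ⟨a, rfl⟩ : ∃ a, x = (1 - Complex.I * p) * a := ⟨_, (mul_div_cancel₀ x p3).symm⟩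
  obtain ⟨b, rfl⟩ : ∃ b, y = (1 - Complex.I * q) * b := ⟨_, (mul_div_cancel₀ y q3).symm⟩
  obtain ⟨c, rfl⟩ : ∃ c, z = (1 - Complex.I * (-q : ℝ)) * c := ⟨_, (mul_div_cancel₀ z r3).symm⟩
  obtain ⟨hR, hJ⟩ := triple_det_of_ne (cayley_row p1 q2 r2 h.row₁) (cayley_row q1 r2 p2 h.row₂)
    (cayley_row r1 p2 q2 h.row₃) rfl rfl rfl (fun h => hx (by rw [h.1, mul_zero]))
  have hq : (3 * q ^ 2 - 1) * q * (q ^ 2 - 1) = 0 := by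
    by_cases hp : p = 0
    · rw [hp] at hR
      have : 3 * q ^ 2 - 1 = 0 := by linear_combination -hR / 2
      rw [this]; ring
    · have hP : 1 - q ^ 2 - p ^ 2 + q ^ 4 = 0 := by
        refine mul_left_cancel₀ hp ?_
        linear_combination hJ / 2
      have h5 : q * ((q * (q ^ 2 - 1)) * (2 * q ^ 4 + q ^ 2 + 1)) = 0 := by
        have hpp : p ^ 2 = 1 - q ^ 2 + q ^ 4 := by linear_combination -hP
        linear_combination hR / 2 - (-1 + q ^ 2 + 2 * q ^ 4) * hpp
      have h6 : 2 * q ^ 4 + q ^ 2 + 1 ≠ 0 := by positivity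
      rcases mul_eq_zero.1 h5 with h7 | h7
      · rw [h7]; ring
      · have h8 := (mul_eq_zero.1 h7).resolve_right h6
        linear_combination (3 * q ^ 2 - 1) * h8
  have hl : ((1 : ℂ) + q ^ 2) * l₂ = -(1 + Complex.I * q) ^ 2 := by
    linear_combination (1 + Complex.I * q) * q1 + q ^ 2 * l₂ * Complex.I_sq
  rcases mul_eq_zero.1 hq with hq | hq
  · rcases mul_eq_zero.1 hq with hq | hq
    · have hc : 3 * (q : ℂ) ^ 2 - 1 = 0 := by exact_mod_cast hq
      have e : l₂ = -1 / 2 - 3 / 2 * Complex.I * q := by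
        linear_combination (3 / 4) * hl - (l₂ / 4 + Complex.I ^ 2 / 4) * hc
          - (1 / 4) * Complex.I_sq
      have e3 : l₂ ^ 2 + l₂ + 1 = 0 := by
        rw [e]
        linear_combination (9 / 4) * q ^ 2 * Complex.I_sq - (3 / 4) * hc
      have e4 : l₂ ^ 3 = 1 := by linear_combination (l₂ - 1) * e3
      calc l₂ ^ 12 = (l₂ ^ 3) ^ 4 := by ring
        _ = 1 := by rw [e4, one_pow]
    · have e : l₂ = -1 := by
        rw [hq] at hl
        push_cast at hl
        linear_combination hl
      rw [e]; norm_num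
  · have hc : (q : ℂ) ^ 2 = 1 := by
      have : q ^ 2 = 1 := by linarith
      exact_mod_cast this
    have e : l₂ = -Complex.I * q := by
      linear_combination hl / 2 - (l₂ / 2 + Complex.I ^ 2 / 2) * hc - Complex.I_sq / 2
    have e4 : l₂ ^ 4 = 1 := by
      have : l₂ ^ 2 = -1 := by
        rw [e]; linear_combination Complex.I ^ 2 * hc + Complex.I_sq
      linear_combination (l₂ ^ 2 - 1) * this
    calc l₂ ^ 12 = (l₂ ^ 4) ^ 3 := by ring
      _ = 1 := by rw [e4, one_pow]

end

lemma pd_sub {n : ℕ} {f g : (Fin n → ℝ) → ℝ} {p : Fin n → ℝ} (hf : DifferentiableAt ℝ f p)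
    (hg : DifferentiableAt ℝ g p) (j : Fin n) :
    pd j (fun q => f q - g q) p = pd j f p - pd j g p := by
  simp only [pd]
  rw [fderiv_fun_sub hf hg]; rfl

lemma pd_mul {n : ℕ} {f g : (Fin n → ℝ) → ℝ} {p : Fin n → ℝ} (hf : DifferentiableAt ℝ f p)
    (hg : DifferentiableAt ℝ g p) (j : Fin n) :
    pd j (fun q => f q * g q) p = pd j f p * g p + f p * pd j g p := by
  simp only [pd]
  rw [fderiv_fun_mul hf hg]
  simp [mul_comm, add_comm]

lemma pd_sum {n : ℕ} {ι : Type*} (s : Finset ι) {f : ι → (Fin n → ℝ) → ℝ} {p : Fin n → ℝ}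
    (hf : ∀ i ∈ s, DifferentiableAt ℝ (f i) p) (j : Fin n) :
    pd j (fun q => ∑ i ∈ s, f i q) p = ∑ i ∈ s, pd j (f i) p := by
  simp only [pd]
  rw [fderiv_fun_sum hf]
  simp

lemma pd_const {n : ℕ} (c : ℝ) (p : Fin n → ℝ) (j : Fin n) : pd j (fun _ => c) p = 0 := by
  simp [pd]

lemma contDiff_pd {n : ℕ} {f : (Fin n → ℝ) → ℝ} (hf : ContDiff ℝ (⊤ : ℕ∞) f) (j : Fin n) :
    ContDiff ℝ (⊤ : ℕ∞) (pd j f) :=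
  (hf.fderiv_right (by exact le_rfl)).clm_apply contDiff_const

lemma pd_comm {n : ℕ} {f : (Fin n → ℝ) → ℝ} (hf : ContDiff ℝ (⊤ : ℕ∞) f) (i j : Fin n)
    (p : Fin n → ℝ) : pd i (pd j f) p = pd j (pd i f) p := by
  have hd : DifferentiableAt ℝ (fderiv ℝ f) p :=
    ((hf.fderiv_right (m := 1) (by exact WithTop.coe_le_coe.2 le_top)).differentiable
      one_ne_zero).differentiableAt
  have h : ∀ i j : Fin n, pd i (pd j f) p
      = fderiv ℝ (fderiv ℝ f) p (Pi.single i 1) (Pi.single j 1) := fun i j => by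
    have := fderiv_clm_apply hd (differentiableAt_const (Pi.single j (1 : ℝ)))
    simp only [pd]
    change fderiv ℝ (fun q => fderiv ℝ f q (Pi.single j 1)) p _ = _
    rw [this]
    simp
  rw [h, h]
  exact (hf.contDiffAt.isSymmSndFDerivAt (by simp; exact WithTop.coe_le_coe.2 le_top)).eq _ _

/-- If the rows `b_j·∂_j b_i` vanish and the columns of `b` are divergence free, then the
quadratic expression `∑ ∂_i b_jk ∂_j b_ik` vanishes. -/
lemma sum_pd_mul_pd_eq_zero {n : ℕ} {b : (Fin n → ℝ) → Matrix (Fin n) (Fin n) ℝ}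
    (hb : ∀ u v : Fin n, ContDiff ℝ (⊤ : ℕ∞) (fun p => b p u v))
    (h1 : ∀ p i, ∑ j, ∑ k, b p j k * pd j (fun q => b q i k) p = 0)
    (h2 : ∀ p k, ∑ i, pd i (fun q => b q i k) p = 0) (p : Fin n → ℝ) :
    ∑ i, ∑ j, ∑ k, pd i (fun q => b q j k) p * pd j (fun q => b q i k) p = 0 := by
  have hd : ∀ u v, DifferentiableAt ℝ (fun q => b q u v) p := fun u v =>
    ((hb u v).differentiable (by simp)).differentiableAt
  have hd2 : ∀ j u v, DifferentiableAt ℝ (pd j (fun q => b q u v)) p := fun j u v =>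
    ((contDiff_pd (hb u v) j).differentiable (by simp)).differentiableAt
  have e1 : ∀ i, ∑ j, ∑ k, (pd i (fun q => b q j k) p * pd j (fun q => b q i k) p
      + b p j k * pd i (pd j (fun q => b q i k)) p) = 0 := fun i => by
    have h : pd i (fun p => ∑ j, ∑ k, b p j k * pd j (fun q => b q i k) p) p = 0 := by
      rw [funext fun p => h1 p i]; exact pd_const 0 p i
    rw [pd_sum _ (fun j _ => DifferentiableAt.fun_sum fun k _ => (hd j k).fun_mul (hd2 j i k))] at h
    rw [← h]
    refine Finset.sum_congr rfl fun j _ => ?_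
    rw [pd_sum _ (fun k _ => (hd j k).fun_mul (hd2 j i k))]
    exact Finset.sum_congr rfl fun k _ => (pd_mul (hd j k) (hd2 j i k) i).symm
  have e2 : ∀ j k, ∑ i, pd i (pd j (fun q => b q i k)) p = 0 := fun j k => by
    have h : pd j (fun p => ∑ i, pd i (fun q => b q i k) p) p = 0 := by
      rw [funext fun p => h2 p k]; exact pd_const 0 p j
    rw [pd_sum _ (fun i _ => hd2 i i k)] at h
    rw [← h]
    exact Finset.sum_congr rfl fun i _ => pd_comm (hb i k) i j p
  have e3 : ∑ i, ∑ j, ∑ k, b p j k * pd i (pd j (fun q => b q i k)) p = 0 := by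
    rw [Finset.sum_comm]
    refine Finset.sum_eq_zero fun j _ => ?_
    rw [Finset.sum_comm]
    refine Finset.sum_eq_zero fun k _ => ?_
    rw [← Finset.mul_sum, e2, mul_zero]
  have e4 := Finset.sum_eq_zero (s := Finset.univ) fun i _ => e1 i
  simp only [Finset.sum_add_distrib] at e4
  rwa [e3, add_zero] at e4

/-- A smooth matrix field whose partial derivatives vanish is constant. -/
lemma eq_of_pd_eq_zero {n : ℕ} {f : (Fin n → ℝ) → ℝ} (hf : Differentiable ℝ f)
    (h : ∀ j p, pd j f p = 0) (p q : Fin n → ℝ) : f p = f q := by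
  refine is_const_of_fderiv_eq_zero hf (fun p => ?_) p q
  refine ContinuousLinearMap.coe_injective ((Pi.basisFun ℝ (Fin n)).ext fun j => ?_)
  simpa [pd] using h j p

/-- The components of `Aᵀ ∂_l A`. -/
noncomputable def logPd {n : ℕ} (a : (Fin n → ℝ) → Matrix (Fin n) (Fin n) ℝ)
    (p : Fin n → ℝ) (l i k : Fin n) : ℝ :=
  ∑ m, a p m i * pd l (fun q => a q m k) p

lemma sum_mul_sum_of_orthogonal {n : ℕ} {A : Matrix (Fin n) (Fin n) ℝ} (hA : Aᵀ * A = 1)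
    (f : Fin n → ℝ) (i : Fin n) : ∑ m, A m i * ∑ t, A m t * f t = f i := by
  have h : (Aᵀ * A).mulVec f i = f i := by rw [hA, one_mulVec]
  rw [← mulVec_mulVec] at h
  simpa [mulVec, dotProduct] using h

lemma sum_mul_sum_of_orthogonal' {n : ℕ} {A : Matrix (Fin n) (Fin n) ℝ} (hA : Aᵀ * A = 1)
    (f : Fin n → ℝ) (i : Fin n) : ∑ m, A i m * ∑ t, A t m * f t = f i := by
  have h : (A * Aᵀ).mulVec f i = f i := by rw [mul_eq_one_comm.1 hA, one_mulVec]
  rw [← mulVec_mulVec] at h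
  simpa [mulVec, dotProduct] using h

lemma sum_sum_mul_sum_of_orthogonal {n : ℕ} {A : Matrix (Fin n) (Fin n) ℝ} (hA : Aᵀ * A = 1)
    (f g : Fin n → ℝ) :
    ∑ k, (∑ t, A k t * f t) * (∑ t, A k t * g t) = ∑ t, f t * g t := by
  simp_rw [Finset.sum_mul]
  rw [Finset.sum_comm]
  refine Finset.sum_congr rfl fun t _ => ?_
  rw [← sum_mul_sum_of_orthogonal hA g t, Finset.mul_sum]
  exact Finset.sum_congr rfl fun m _ => by ring

section
variable {n : ℕ} {a : (Fin n → ℝ) → Matrix (Fin n) (Fin n) ℝ}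

lemma pd_eq_sum_logPd (horth : ∀ p, (a p)ᵀ * a p = 1) (p : Fin n → ℝ) (l m k : Fin n) :
    pd l (fun q => a q m k) p = ∑ t, a p m t * logPd a p l t k :=
  (sum_mul_sum_of_orthogonal' (horth p) (fun m => pd l (fun q => a q m k) p) m).symm

lemma logPd_swap (hsmooth : ∀ u v, ContDiff ℝ (⊤ : ℕ∞) (fun p => a p u v))
    (horth : ∀ p, (a p)ᵀ * a p = 1) (p : Fin n → ℝ) (l i k : Fin n) :
    logPd a p l k i = -logPd a p l i k := by
  have hd : ∀ u v, DifferentiableAt ℝ (fun q => a q u v) p := fun u v =>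
    ((hsmooth u v).differentiable (by simp)).differentiableAt
  have h : pd l (fun q => ∑ m, a q m i * a q m k) p = 0 := by
    have : (fun q => ∑ m, a q m i * a q m k) = fun _ => (1 : Matrix (Fin n) (Fin n) ℝ) i k := by
      funext q
      rw [← horth q]
      simp [mul_apply]
    rw [this, pd_const]
  rw [pd_sum _ fun m _ => (hd m i).fun_mul (hd m k)] at h
  simp_rw [pd_mul (hd _ i) (hd _ k), Finset.sum_add_distrib] at h
  simp only [logPd]
  rw [eq_neg_iff_add_eq_zero, ← h]
  congr 1
  exact Finset.sum_congr rfl fun m _ => mul_comm _ _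

end

/-- A cyclic linear system together with an isometry and an orthogonality condition forces the
unknown to vanish. -/
lemma eq_zero_of_cyclic {ι : Type*} [Fintype ι] (σ : ι ≃ ι) (hσ : ∀ e, σ (σ (σ e)) = e)
    {x y : ι → ℝ} (h : ∀ e, y e = x (σ e) + x (σ (σ e)) + y (σ e) + y (σ (σ e)))
    (hnorm : ∑ e, y e ^ 2 = ∑ e, x e ^ 2) (hx : ∑ e, x e * x (σ e) = 0) (e : ι) : x e = 0 := by
  set t : ι → ℝ := fun e => x e + y e with ht
  have hy : ∀ e, y e = t (σ e) + t (σ (σ e)) := fun e => by rw [h e]; simp only [ht]; ring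
  have hxt : ∀ e, x e = t e - t (σ e) - t (σ (σ e)) := fun e => by
    have := hy e
    simp only [ht] at this ⊢
    linarith
  have s1 : ∑ e, t (σ e) ^ 2 = ∑ e, t e ^ 2 := Equiv.sum_comp σ fun e => t e ^ 2
  have s2 : ∑ e, t (σ (σ e)) ^ 2 = ∑ e, t e ^ 2 := by
    rw [← s1]; exact Equiv.sum_comp σ fun e => t (σ e) ^ 2
  have s3 : ∑ e, t (σ e) * t (σ (σ e)) = ∑ e, t e * t (σ e) :=
    Equiv.sum_comp σ fun e => t e * t (σ e)
  have s4 : ∑ e, t e * t (σ (σ e)) = ∑ e, t e * t (σ e) := by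
    rw [← Equiv.sum_comp σ fun e => t e * t (σ (σ e))]
    exact Finset.sum_congr rfl fun e _ => by rw [hσ]; ring
  have k1 : ∑ e, (2 * (t e * t (σ e)) + 2 * (t e * t (σ (σ e))) - t e ^ 2) = 0 := by
    rw [← sub_eq_zero, ← Finset.sum_sub_distrib] at hnorm
    rw [← hnorm]
    refine Finset.sum_congr rfl fun e _ => ?_
    rw [hy, hxt]
    ring
  have k2 : ∑ e, (2 * (t e * t (σ e)) - t e ^ 2 - t (σ e) ^ 2 + t (σ (σ e)) ^ 2) = 0 := by
    rw [← hx]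
    refine Finset.sum_congr rfl fun e _ => ?_
    rw [hxt, hxt (σ e), hσ]
    ring
  simp only [Finset.sum_add_distrib, Finset.sum_sub_distrib, ← Finset.mul_sum, s1, s2, s4]
    at k1 k2
  have k3 : ∑ e, t e ^ 2 = 0 := by linarith
  have k4 : ∀ e, t e = 0 := fun e => by
    simpa using (Finset.sum_eq_zero_iff_of_nonneg fun e _ => sq_nonneg (t e)).1 k3 e
  rw [hxt, k4, k4, k4]
  ring

/-- The cyclic permutation of the coordinates of a triple. -/
def cycleTriple (α : Type*) : α × α × α ≃ α × α × α where
  toFun e := (e.2.1, e.2.2, e.1)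
  invFun e := (e.2.2, e.1, e.2.1)
  left_inv _ := rfl
  right_inv _ := rfl

theorem pd_eq_zero_of_pde {n : ℕ} {a : (Fin n → ℝ) → Matrix (Fin n) (Fin n) ℝ}
    (hsmooth : ∀ u v : Fin n, ContDiff ℝ (⊤ : ℕ∞) (fun p => a p u v))
    (horth : ∀ p : Fin n → ℝ, (a p)ᵀ * a p = 1)
    (h : ∀ (m i k : Fin n) (p : Fin n → ℝ),
        pd i (fun q => a q m k) p - pd k (fun q => a q m i) p
          + (∑ l : Fin n, (a p l i * pd l (fun q => a q m k) p
              - a p l k * pd l (fun q => a q m i) p))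
          + (∑ j : Fin n, a p j i * pd m (fun q => a q j k) p)
          + (∑ l : Fin n, ∑ j : Fin n, a p m j * a p l j * pd j (fun q => a q l k) p)
        = 0) (l m k : Fin n) (p : Fin n → ℝ) : pd l (fun q => a q m k) p = 0 := by
  have hsw := logPd_swap hsmooth horth
  have hself : ∀ p l i, logPd a p l i i = 0 := fun p l i => by
    have := hsw p l i i; linarith
  have hcubic : ∀ p m k, ∑ l, ∑ j, a p m j * a p l j * pd j (fun q => a q l k) p
      = ∑ j, a p m j * logPd a p j j k := fun p m k => by
    rw [Finset.sum_comm]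
    refine Finset.sum_congr rfl fun j _ => ?_
    rw [logPd, Finset.mul_sum]
    exact Finset.sum_congr rfl fun l _ => by ring
  have hdiag : ∀ p j k, logPd a p j j k = 0 := fun p j k => by
    rw [← sum_mul_sum_of_orthogonal (horth p) (fun j => logPd a p j j k) j]
    refine Finset.sum_eq_zero fun m _ => ?_
    have := h m k k p
    rw [hcubic] at this
    have h2 := hself p m k
    rw [logPd] at h2
    rw [h2] at this
    simp only [sub_self, Finset.sum_const_zero, add_zero, zero_add] at this
    rw [this, mul_zero]
  have hmain : ∀ p N i k, logPd a p i N k - logPd a p k N i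
      + (∑ l, a p l i * logPd a p l N k - ∑ l, a p l k * logPd a p l N i)
      + ∑ m, a p m N * logPd a p m i k = 0 := fun p N i k => by
    have e : ∀ m, a p m N * (pd i (fun q => a q m k) p - pd k (fun q => a q m i) p
          + (∑ l : Fin n, (a p l i * pd l (fun q => a q m k) p
              - a p l k * pd l (fun q => a q m i) p)) + logPd a p m i k) = 0 := fun m => by
      have := h m i k p
      rw [hcubic] at this
      simp only [hdiag, mul_zero, Finset.sum_const_zero, add_zero] at this
      rw [logPd, this, mul_zero]
    have e2 := Finset.sum_eq_zero (s := Finset.univ) fun m _ => e m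
    simp only [mul_add, mul_sub, Finset.sum_add_distrib, Finset.sum_sub_distrib,
      Finset.mul_sum] at e2
    rw [Finset.sum_comm (f := fun m l => a p m N * (a p l i * pd l (fun q => a q m k) p)),
      Finset.sum_comm (f := fun m l => a p m N * (a p l k * pd l (fun q => a q m i) p))] at e2
    rw [← e2]
    simp only [logPd, Finset.mul_sum, mul_left_comm]
  have hQ := sum_pd_mul_pd_eq_zero (b := fun p => (a p)ᵀ) (fun u v => hsmooth v u)
    (fun p i => by
      simp only [transpose_apply]
      exact Finset.sum_eq_zero fun j _ => hdiag p j i)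
    (fun p k => by
      simp only [transpose_apply]
      simp_rw [pd_eq_sum_logPd horth p _ k]
      refine Finset.sum_eq_zero fun i _ => Finset.sum_eq_zero fun t _ => ?_
      rw [hsw, hdiag]; simp) p
  simp only [transpose_apply] at hQ
  have hzero : ∀ l i k, logPd a p l i k = 0 := by
    intro l i k
    refine eq_zero_of_cyclic (cycleTriple (Fin n)) (fun _ => rfl)
      (x := fun e => logPd a p e.1 e.2.1 e.2.2)
      (y := fun e => ∑ l, a p l e.1 * logPd a p l e.2.1 e.2.2) ?_ ?_ ?_ (l, i, k)
    · rintro ⟨N, i, k⟩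
      have := hmain p N i k
      simp only [cycleTriple, Equiv.coe_fn_mk]
      rw [hsw p i k N] at this
      simp_rw [hsw p _ k N] at this
      simp only [mul_neg, Finset.sum_neg_distrib] at this
      linarith
    · simp only [Fintype.sum_prod_type_right (f := fun e : Fin n × Fin n × Fin n => _)]
      refine Finset.sum_congr rfl fun e _ => ?_
      have := sum_sum_mul_sum_of_orthogonal (A := (a p)ᵀ)
        (by rw [transpose_transpose]; exact mul_eq_one_comm.1 (horth p))
        (fun l => logPd a p l e.1 e.2) (fun l => logPd a p l e.1 e.2)
      simpa only [transpose_apply, ← sq] using this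
    · simp_rw [pd_eq_sum_logPd horth p _ _] at hQ
      simp_rw [sum_sum_mul_sum_of_orthogonal (horth p)] at hQ
      rw [← neg_eq_zero, ← hQ, Finset.sum_comm, ← Finset.sum_neg_distrib]
      simp only [Fintype.sum_prod_type, cycleTriple, Equiv.coe_fn_mk]
      refine Finset.sum_congr rfl fun N _ => Finset.sum_congr rfl fun i _ => ?_
      refine Finset.sum_congr rfl fun k _ => ?_
      rw [hsw p N i k]
      ring
  rw [pd_eq_sum_logPd horth]
  simp [hzero]

/-- The contraction of a three-index array with three vectors. -/
noncomputable def contract₃ {n : ℕ} (T : Fin n → Fin n → Fin n → ℂ) (x y z : Fin n → ℂ) : ℂ :=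
  ∑ l, ∑ i, ∑ k, x l * y i * z k * T l i k

section
variable {n : ℕ} (T T' : Fin n → Fin n → Fin n → ℂ) (x y z : Fin n → ℂ)

lemma contract₃_add : contract₃ (fun l i k => T l i k + T' l i k) x y z
    = contract₃ T x y z + contract₃ T' x y z := by
  simp only [contract₃, mul_add, Finset.sum_add_distrib]

lemma contract₃_sub : contract₃ (fun l i k => T l i k - T' l i k) x y z
    = contract₃ T x y z - contract₃ T' x y z := by
  simp only [contract₃, mul_sub, Finset.sum_sub_distrib]

lemma contract₃_neg : contract₃ (fun l i k => -T l i k) x y z = -contract₃ T x y z := by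
  simp only [contract₃, mul_neg, Finset.sum_neg_distrib]

lemma contract₃_const_mul (c : ℂ) :
    contract₃ (fun l i k => c * T l i k) x y z = c * contract₃ T x y z := by
  simp only [contract₃, Finset.mul_sum]
  exact Finset.sum_congr rfl fun _ _ => Finset.sum_congr rfl fun _ _ =>
    Finset.sum_congr rfl fun _ _ => by ring

lemma contract₃_swap₁₂ : contract₃ (fun l i k => T i l k) x y z = contract₃ T y x z := by
  simp only [contract₃]
  rw [Finset.sum_comm]
  exact Finset.sum_congr rfl fun _ _ => Finset.sum_congr rfl fun _ _ =>
    Finset.sum_congr rfl fun _ _ => by ring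

lemma contract₃_swap₂₃ : contract₃ (fun l i k => T l k i) x y z = contract₃ T x z y := by
  simp only [contract₃]
  refine Finset.sum_congr rfl fun _ _ => ?_
  rw [Finset.sum_comm]
  exact Finset.sum_congr rfl fun _ _ => Finset.sum_congr rfl fun _ _ => by ring

variable {x y z} {M : Fin n → Fin n → ℂ} {c : ℂ}

lemma contract₃_slot₁ (h : ∀ t, ∑ l, x l * M l t = c * x t) :
    contract₃ (fun l i k => ∑ t, M l t * T t i k) x y z = c * contract₃ T x y z := by
  simp only [contract₃, Finset.mul_sum]
  have e : ∀ t, ∑ l, ∑ i, ∑ k, x l * y i * z k * (M l t * T t i k)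
      = ∑ i, ∑ k, c * (x t * y i * z k * T t i k) := fun t => by
    rw [Finset.sum_comm]
    refine Finset.sum_congr rfl fun i _ => ?_
    rw [Finset.sum_comm]
    refine Finset.sum_congr rfl fun k _ => ?_
    calc _ = (∑ l, x l * M l t) * (y i * z k * T t i k) := by
          rw [Finset.sum_mul]
          exact Finset.sum_congr rfl fun l _ => by ring
      _ = _ := by rw [h]; ring
  rw [← Finset.sum_congr rfl fun t _ => e t]
  conv_rhs => rw [Finset.sum_comm]
  refine Finset.sum_congr rfl fun l _ => ?_
  conv_rhs => rw [Finset.sum_comm]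
  refine Finset.sum_congr rfl fun i _ => ?_
  rw [Finset.sum_comm]

lemma contract₃_slot₂ (h : ∀ t, ∑ l, y l * M l t = c * y t) :
    contract₃ (fun l i k => ∑ t, M i t * T l t k) x y z = c * contract₃ T x y z := by
  have := contract₃_slot₁ (fun i l k => T l i k) h (y := x) (z := z)
  rwa [contract₃_swap₁₂ T, ← contract₃_swap₁₂] at this

lemma contract₃_slot₃ (h : ∀ t, ∑ l, z l * M l t = c * z t) :
    contract₃ (fun l i k => ∑ t, M k t * T l i t) x y z = c * contract₃ T x y z := by
  have := contract₃_slot₂ (fun l k i => T l i k) h (x := x) (z := y)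
  rwa [contract₃_swap₂₃ T, ← contract₃_swap₂₃] at this

end

section
variable {n : ℕ} {a : (Fin n → ℝ) → Matrix (Fin n) (Fin n) ℝ}

lemma logPd_relation (hsmooth : ∀ u v, ContDiff ℝ (⊤ : ℕ∞) (fun p => a p u v))
    (horth : ∀ p, (a p)ᵀ * a p = 1) {i k : Fin n} {p : Fin n → ℝ}
    (h : (1 + a p).mulVec (formBracket (alphaForm a i) (alphaForm a k) p) =
          (1 - a p).mulVec (lieBracket (alphaForm a i) (alphaForm a k) p)) (l : Fin n) :
    2 * (∑ t, a p l t * (-logPd a p i t k + logPd a p k t i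
        + (∑ j, a p j i * logPd a p j t k - ∑ j, a p j k * logPd a p j t i)))
      + ∑ t, a p t l * (∑ j, a p i j * logPd a p t j k - ∑ j, a p k j * logPd a p t j i
          - 2 * logPd a p t i k)
      + (∑ j, a p i j * logPd a p l j k - ∑ j, a p k j * logPd a p l j i
          - 2 * logPd a p l i k) = 0 := by
  set A := a p with hA
  have hd : ∀ u v, DifferentiableAt ℝ (fun q => a q u v) p := fun u v =>
    ((hsmooth u v).differentiable (by simp)).differentiableAt
  have hal : ∀ t l k, pd t (fun q => (if l = k then (1 : ℝ) else 0) - a q l k) p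
      = -pd t (fun q => a q l k) p := fun t l k => by
      rw [pd_sub (differentiableAt_const _) (hd l k), pd_const, zero_sub]
  set L : Fin n → ℝ := fun t => -pd i (fun q => a q t k) p + pd k (fun q => a q t i) p
        + (∑ j, A j i * pd j (fun q => a q t k) p - ∑ j, A j k * pd j (fun q => a q t i) p)
    with hL
  set L' : Fin n → ℝ := fun t => -logPd a p i t k + logPd a p k t i
        + (∑ j, A j i * logPd a p j t k - ∑ j, A j k * logPd a p j t i) with hL'
  set G : Fin n → ℝ := fun l => ∑ j, A i j * logPd a p l j k - ∑ j, A k j * logPd a p l j i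
          - 2 * logPd a p l i k with hG
  have e1 : lieBracket (alphaForm a i) (alphaForm a k) p = L := by
    funext t
    simp only [lieBracket, hL, alphaForm, ← hA, hal]
    simp only [sub_mul, ite_mul, one_mul, zero_mul, mul_neg, neg_sub, Finset.sum_sub_distrib,
      Finset.sum_ite_eq', Finset.mem_univ, if_true]
    ring
  have e2 : formBracket (alphaForm a i) (alphaForm a k) p = L + G := by
    funext t
    have hp : (fun q => pairF (alphaForm a i) (alphaForm a k) q
        - pairF (alphaForm a k) (alphaForm a i) q) = fun _ => (0 : ℝ) := by
      funext q
      simp [pairF, mul_comm]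
    simp only [formBracket, hp, pd_const, contrD, alphaForm, hal, Pi.add_apply, hL, hG]
    rw [← pd_eq_sum_logPd horth, ← pd_eq_sum_logPd horth]
    have hs := logPd_swap hsmooth horth p t i k
    have e3 : logPd a p t i k = ∑ m, A m i * pd t (fun q => a q m k) p := rfl
    have e4 : logPd a p t k i = ∑ m, A m k * pd t (fun q => a q m i) p := rfl
    simp only [← hA]
    simp only [sub_mul, ite_mul, one_mul, zero_mul, mul_neg, neg_sub, mul_sub,
      Finset.sum_sub_distrib, Finset.sum_ite_eq', Finset.mem_univ, if_true, ← e3, ← e4]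
    linarith
  have e5 : A.mulVec L' = L := by
    funext t
    simp only [mulVec, dotProduct, hL', hL]
    rw [pd_eq_sum_logPd horth, pd_eq_sum_logPd horth p k]
    simp_rw [pd_eq_sum_logPd horth p _ t]
    simp only [mul_add, mul_sub, mul_neg, Finset.sum_add_distrib, Finset.sum_sub_distrib,
      Finset.sum_neg_distrib, Finset.mul_sum]
    rw [Finset.sum_comm (f := fun m l => A t m * (A l i * logPd a p l m k)),
      Finset.sum_comm (f := fun m l => A t m * (A l k * logPd a p l m i))]
    simp only [hA, mul_left_comm]
  rw [e1, e2] at h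
  have e6 : (2 : ℝ) • A.mulVec L + (G + A.mulVec G) = 0 := by
    rw [add_mulVec, sub_mulVec, one_mulVec, one_mulVec, mulVec_add] at h
    funext t
    have := congrFun h t
    simp only [Pi.add_apply, Pi.sub_apply, Pi.smul_apply, smul_eq_mul, Pi.zero_apply] at this ⊢
    linarith
  have e7 : (2 : ℝ) • A.mulVec L' + (Aᵀ.mulVec G + G) = 0 := by
    have := congrArg Aᵀ.mulVec e6
    rw [mulVec_add, mulVec_smul, mulVec_add, mulVec_mulVec, mulVec_mulVec, hA, horth, one_mulVec,
      one_mulVec, mulVec_zero, ← hA] at this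
    rwa [e5]
  have := congrFun e7 l
  simp only [Pi.add_apply, Pi.smul_apply, smul_eq_mul, mulVec, dotProduct, transpose_apply,
    Pi.zero_apply] at this
  linarith

/-- The contracted form of the integrability relation on eigenvectors of `A`. -/
lemma contract_logPd_relation (hsmooth : ∀ u v, ContDiff ℝ (⊤ : ℕ∞) (fun p => a p u v))
    (horth : ∀ p, (a p)ᵀ * a p = 1) {p : Fin n → ℝ}
    (h : ∀ i k, (1 + a p).mulVec (formBracket (alphaForm a i) (alphaForm a k) p) =
          (1 - a p).mulVec (lieBracket (alphaForm a i) (alphaForm a k) p))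
    {x y z : Fin n → ℂ} {lx ly lz mx my mz : ℂ}
    (hx : ∀ t, ∑ l, x l * (a p t l : ℂ) = lx * x t) (hx' : ∀ t, ∑ l, x l * (a p l t : ℂ) = mx * x t)
    (hy : ∀ t, ∑ l, y l * (a p t l : ℂ) = ly * y t) (hy' : ∀ t, ∑ l, y l * (a p l t : ℂ) = my * y t)
    (hz : ∀ t, ∑ l, z l * (a p t l : ℂ) = lz * z t) (hz' : ∀ t, ∑ l, z l * (a p l t : ℂ) = mz * z t) :
    (1 + lx) * (2 - my - mz) * contract₃ (fun l i k => (logPd a p l i k : ℂ)) x y z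
      = 2 * mx * ((1 - ly) * contract₃ (fun l i k => (logPd a p l i k : ℂ)) y z x
        + (1 - lz) * contract₃ (fun l i k => (logPd a p l i k : ℂ)) z x y) := by
  set T : Fin n → Fin n → Fin n → ℂ := fun l i k => (logPd a p l i k : ℂ) with hT
  have hsw : ∀ x y z, contract₃ T x z y = -contract₃ T x y z := fun x y z => by
    rw [← contract₃_neg, ← contract₃_swap₂₃]
    congr 1
    funext l i k
    simp only [hT]
    rw [logPd_swap hsmooth horth]
    push_cast
    rfl
  have e : contract₃ (fun l i k => 2 * (∑ t, (a p l t : ℂ) * (-T i t k + T k t i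
        + (∑ j, (a p j i : ℂ) * T j t k - ∑ j, (a p j k : ℂ) * T j t i)))
      + ∑ t, (a p t l : ℂ) * (∑ j, (a p i j : ℂ) * T t j k - ∑ j, (a p k j : ℂ) * T t j i
          - 2 * T t i k)
      + (∑ j, (a p i j : ℂ) * T l j k - ∑ j, (a p k j : ℂ) * T l j i
          - 2 * T l i k)) x y z = 0 := by
    have : ∀ l i k, 2 * (∑ t, (a p l t : ℂ) * (-T i t k + T k t i
        + (∑ j, (a p j i : ℂ) * T j t k - ∑ j, (a p j k : ℂ) * T j t i)))
      + ∑ t, (a p t l : ℂ) * (∑ j, (a p i j : ℂ) * T t j k - ∑ j, (a p k j : ℂ) * T t j i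
          - 2 * T t i k)
      + (∑ j, (a p i j : ℂ) * T l j k - ∑ j, (a p k j : ℂ) * T l j i
          - 2 * T l i k) = 0 := fun l i k => by
      have := logPd_relation hsmooth horth (h i k) l
      simp only [hT]
      exact_mod_cast this
    simp only [this]
    simp [contract₃]
  have s1 : ∀ T, contract₃ (fun l i k => ∑ t, (a p l t : ℂ) * T t i k) x y z
      = mx * contract₃ T x y z := fun T => contract₃_slot₁ T hx'
  have s2 : ∀ T, contract₃ (fun l i k => ∑ t, (a p t l : ℂ) * T t i k) x y z
      = lx * contract₃ T x y z := fun T => contract₃_slot₁ (M := fun l t => (a p t l : ℂ)) T hx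
  have s3 : ∀ T, contract₃ (fun l i k => ∑ t, (a p i t : ℂ) * T l t k) x y z
      = my * contract₃ T x y z := fun T => contract₃_slot₂ T hy'
  have s4 : ∀ T, contract₃ (fun l i k => ∑ t, (a p t i : ℂ) * T l t k) x y z
      = ly * contract₃ T x y z := fun T => contract₃_slot₂ (M := fun l t => (a p t l : ℂ)) T hy
  have s5 : ∀ T, contract₃ (fun l i k => ∑ t, (a p k t : ℂ) * T l i t) x y z
      = mz * contract₃ T x y z := fun T => contract₃_slot₃ T hz'
  have s6 : ∀ T, contract₃ (fun l i k => ∑ t, (a p t k : ℂ) * T l i t) x y z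
      = lz * contract₃ T x y z := fun T => contract₃_slot₃ (M := fun l t => (a p t l : ℂ)) T hz
  have c1 : contract₃ (fun l i k => T i l k) x y z = -contract₃ T y z x := by
    rw [contract₃_swap₁₂, ← hsw]
  have c2 : contract₃ (fun l i k => T k l i) x y z = contract₃ T z x y := by
    rw [contract₃_swap₂₃ (fun l i k => T i l k), contract₃_swap₁₂]
  have c3 : contract₃ (fun l i k => T l k i) x y z = -contract₃ T x y z := by
    rw [contract₃_swap₂₃, hsw]
  simp only [contract₃_add, contract₃_sub, contract₃_neg, contract₃_const_mul, s1, s2, s3, s4,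
    s5, s6, c1, c2, c3] at e
  linear_combination -e
end

lemma exists_orthonormalBasis_of_inner_map_map {E : Type*} [NormedAddCommGroup E]
    [InnerProductSpace ℂ E] [FiniteDimensional ℂ E] {n : ℕ} (hn : Module.finrank ℂ E = n)
    (T : E →ₗ[ℂ] E) (hT : ∀ x y, inner ℂ (T x) (T y) = inner ℂ x y) :
    ∃ b : OrthonormalBasis (Fin n) ℂ E, ∀ i, ∃ c : ℂ, T (b i) = c • b i := by
  have hne : ∀ c (x : E), T x = c • x → x ≠ 0 → starRingEnd ℂ c * c = 1 := fun c x h hx => by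
    have := hT x x
    rw [h, inner_smul_left, inner_smul_right, ← mul_assoc] at this
    exact mul_right_cancel₀ (inner_self_ne_zero.2 hx) (by rw [this, one_mul])
  have hfam : OrthogonalFamily ℂ (fun c : Module.End.Eigenvalues T => Module.End.eigenspace T c)
      fun c => (Module.End.eigenspace T c).subtypeₗᵢ := by
    refine OrthogonalFamily.of_pairwise fun c d hcd x hx y hy => ?_
    rw [Module.End.mem_eigenspace_iff] at hx hy
    by_contra hxy
    have hx0 : y ≠ 0 := fun h => hxy (by rw [h]; simp)
    have h1 := hT y x
    have h2 := hne _ _ hy hx0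
    rw [hx, hy, inner_smul_left, inner_smul_right, ← mul_assoc] at h1
    have h3 : starRingEnd ℂ (d : ℂ) * (c : ℂ) = 1 :=
      mul_right_cancel₀ hxy (by rw [one_mul]; exact h1)
    refine hcd (Subtype.ext ?_)
    have h4 : starRingEnd ℂ (d : ℂ) ≠ 0 := left_ne_zero_of_mul_eq_one h3
    exact mul_left_cancel₀ h4 (h3.trans h2.symm)
  have hbot : (⨆ c : Module.End.Eigenvalues T, Module.End.eigenspace T (c : ℂ))ᗮ = ⊥ := by
    set W := (⨆ c : Module.End.Eigenvalues T, Module.End.eigenspace T (c : ℂ))ᗮ with hW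
    have hinv : ∀ w ∈ W, T w ∈ W := fun w hw => by
      rw [hW, ← Submodule.iInf_orthogonal, Submodule.mem_iInf] at hw ⊢
      intro c
      rw [Submodule.mem_orthogonal]
      intro v hv
      have h1 := (Submodule.mem_orthogonal _ _).1 (hw c) v hv
      rw [Module.End.mem_eigenspace_iff] at hv
      rcases eq_or_ne v 0 with rfl | hv0
      · simp
      rw [← hT, hv, inner_smul_left] at h1
      exact (mul_eq_zero.1 h1).resolve_left (left_ne_zero_of_mul_eq_one (hne _ _ hv hv0))
    by_contra hbot
    have : Nontrivial W := Submodule.nontrivial_iff_ne_bot.2 hbot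
    obtain ⟨c, hc⟩ := Module.End.exists_eigenvalue (T.restrict hinv)
    obtain ⟨v, hv, hv0⟩ := hc.exists_hasEigenvector
    rw [Module.End.mem_eigenspace_iff] at hv
    have hv' : T v = c • (v : E) := congrArg Subtype.val hv
    have hv0' : (v : E) ≠ 0 := fun h => hv0 (Subtype.ext h)
    have hc' : Module.End.HasEigenvalue T c :=
      Module.End.hasEigenvalue_of_hasEigenvector ⟨Module.End.mem_eigenspace_iff.2 hv', hv0'⟩
    have hmem : (v : E) ∈ ⨆ c : Module.End.Eigenvalues T, Module.End.eigenspace T (c : ℂ) :=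
      Submodule.mem_iSup_of_mem (⟨c, hc'⟩ : Module.End.Eigenvalues T)
        (Module.End.mem_eigenspace_iff.2 hv')
    exact hv0' (inner_self_eq_zero.1 ((Submodule.mem_orthogonal _ _).1 v.2 _ hmem))
  classical
  have hinternal := (hfam.isInternal_iff).2 hbot
  exact ⟨hinternal.subordinateOrthonormalBasis hn hfam, fun i => ⟨_, Module.End.mem_eigenspace_iff.1
    (hinternal.subordinateOrthonormalBasis_subordinate hn i hfam)⟩⟩

/-- Diagonalization of a real orthogonal matrix by a unitary matrix whose rows are eigenvectors. -/
lemma exists_unitary_diagonalization {n : ℕ} {A : Matrix (Fin n) (Fin n) ℝ} (hA : Aᵀ * A = 1) :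
    ∃ (V : Matrix (Fin n) (Fin n) ℂ) (c : Fin n → ℂ), (∀ α, starRingEnd ℂ (c α) * c α = 1) ∧
      (∀ α t, ∑ l, V α l * (A t l : ℂ) = c α * V α t) ∧
      (∀ α t, ∑ l, V α l * (A l t : ℂ) = starRingEnd ℂ (c α) * V α t) ∧
      V * Vᴴ = 1 := by
  set B : Matrix (Fin n) (Fin n) ℂ := A.map Complex.ofReal with hB
  have hAA : ∀ i j, ∑ t, (A t i : ℂ) * (A t j : ℂ) = if i = j then 1 else 0 := fun i j => by
    have := congrFun (congrFun hA i) j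
    simp only [mul_apply, transpose_apply, one_apply] at this
    rw [← Complex.ofReal_one, ← Complex.ofReal_zero, ← apply_ite Complex.ofReal, ← this]
    push_cast
    rfl
  have hBB : Bᴴ * B = 1 := by
    ext i j
    simp only [mul_apply, conjTranspose_apply, hB, map_apply, one_apply, RCLike.star_def,
      Complex.conj_ofReal, hAA]
  have hiso : ∀ x y, inner ℂ (toEuclideanLin B x) (toEuclideanLin B y) = inner ℂ x y :=
    fun x y => by
      simp only [EuclideanSpace.inner_eq_star_dotProduct, ofLp_toLpLin, toLin'_apply, star_mulVec,
        dotProduct_comm (B *ᵥ _), ← dotProduct_mulVec, mulVec_mulVec, hBB, one_mulVec]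
      exact dotProduct_comm _ _
  obtain ⟨b, hb⟩ := exists_orthonormalBasis_of_inner_map_map (n := n) (by simp)
    (toEuclideanLin B) hiso
  choose c hc using hb
  have h1 : ∀ α t, ∑ l, b α l * (A t l : ℂ) = c α * b α t := fun α t => by
    have := congrArg (fun v => v t) (hc α)
    simpa [toLpLin_apply, mulVec, dotProduct, hB, mul_comm] using this
  have h0 : ∀ α, starRingEnd ℂ (c α) * c α = 1 := fun α => by
    have := hiso (b α) (b α)
    rw [hc, inner_smul_left, inner_smul_right, orthonormal_iff_ite.1 b.orthonormal] at this
    simpa using this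
  refine ⟨Matrix.of fun α l => b α l, c, h0, h1, fun α t => ?_, ?_⟩
  · have h2 : ∀ m, (b α m : ℂ) = starRingEnd ℂ (c α) * ∑ l, b α l * (A m l : ℂ) := fun m => by
      rw [h1, ← mul_assoc, h0, one_mul]
    simp only [of_apply]
    calc ∑ l, b α l * (A l t : ℂ)
        = ∑ l, ∑ m, starRingEnd ℂ (c α) * (b α m * ((A l m : ℂ) * (A l t : ℂ))) := by
          refine Finset.sum_congr rfl fun l _ => ?_
          conv_lhs => rw [h2 l]
          rw [Finset.mul_sum, Finset.sum_mul]
          exact Finset.sum_congr rfl fun m _ => by ring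
      _ = _ := by
          rw [Finset.sum_comm]
          simp only [← Finset.mul_sum, hAA, mul_ite, mul_one, mul_zero, Finset.sum_ite_eq',
            Finset.mem_univ, if_true]
  · ext α β
    have := orthonormal_iff_ite.1 b.orthonormal β α
    rw [PiLp.inner_apply] at this
    simpa [mul_apply, one_apply, eq_comm] using this

/-- `x` is an eigenvector, with unit eigenvalue `l`, of the real matrix `A`, and of `Aᵀ` for the
conjugate eigenvalue. -/
structure UnitEigen {n : ℕ} (A : Matrix (Fin n) (Fin n) ℝ) (l : ℂ) (x : Fin n → ℂ) : Prop where
  unit : (starRingEnd ℂ) l * l = 1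
  right : ∀ t, ∑ s, x s * (A t s : ℂ) = l * x t
  left : ∀ t, ∑ s, x s * (A s t : ℂ) = (starRingEnd ℂ) l * x t

lemma UnitEigen.conj {n : ℕ} {A : Matrix (Fin n) (Fin n) ℝ} {l : ℂ} {x : Fin n → ℂ}
    (h : UnitEigen A l x) : UnitEigen A ((starRingEnd ℂ) l) fun t => (starRingEnd ℂ) (x t) where
  unit := by rw [Complex.conj_conj, mul_comm]; exact h.unit
  right t := by simpa using congrArg (starRingEnd ℂ) (h.right t)
  left t := by simpa using congrArg (starRingEnd ℂ) (h.left t)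

lemma UnitEigen.right_pow {n : ℕ} {A : Matrix (Fin n) (Fin n) ℝ} {l : ℂ} {x : Fin n → ℂ}
    (h : UnitEigen A l x) (k : ℕ) (t : Fin n) :
    ∑ s, x s * ((A ^ k) t s : ℂ) = l ^ k * x t := by
  induction k generalizing t with
  | zero => simp [one_apply, apply_ite Complex.ofReal]
  | succ k ih =>
    rw [pow_succ']
    simp only [mul_apply, Complex.ofReal_sum, Complex.ofReal_mul, Finset.mul_sum]
    rw [Finset.sum_comm]
    simp_rw [mul_left_comm (x _), ← Finset.mul_sum, ih]
    rw [pow_succ', mul_right_comm, ← h.right, Finset.sum_mul]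
    exact Finset.sum_congr rfl fun s _ => by ring

lemma UnitEigen.left_pow {n : ℕ} {A : Matrix (Fin n) (Fin n) ℝ} {l : ℂ} {x : Fin n → ℂ}
    (h : UnitEigen A l x) (k : ℕ) (t : Fin n) :
    ∑ s, x s * ((A ^ k) s t : ℂ) = (starRingEnd ℂ) l ^ k * x t := by
  induction k generalizing t with
  | zero => simp [one_apply, apply_ite Complex.ofReal]
  | succ k ih =>
    rw [pow_succ]
    simp only [mul_apply, Complex.ofReal_sum, Complex.ofReal_mul, Finset.mul_sum]
    rw [Finset.sum_comm]
    simp_rw [← mul_assoc, ← Finset.sum_mul, ih]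
    rw [pow_succ, mul_assoc, ← h.left, Finset.mul_sum]
    exact Finset.sum_congr rfl fun s _ => by ring

/-- The complexified array of logarithmic derivatives. -/
noncomputable def logTensor {n : ℕ} (a : (Fin n → ℝ) → Matrix (Fin n) (Fin n) ℝ) (p : Fin n → ℝ)
    (l i k : Fin n) : ℂ := logPd a p l i k

section
variable {n : ℕ} {a : (Fin n → ℝ) → Matrix (Fin n) (Fin n) ℝ}

lemma contract₃_logTensor_swap (hsmooth : ∀ u v, ContDiff ℝ (⊤ : ℕ∞) (fun p => a p u v))
    (horth : ∀ p, (a p)ᵀ * a p = 1) (p : Fin n → ℝ) (x y z : Fin n → ℂ) :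
    contract₃ (logTensor a p) x z y = -contract₃ (logTensor a p) x y z := by
  rw [← contract₃_neg, ← contract₃_swap₂₃]
  congr 1
  funext l i k
  simp only [logTensor]
  rw [logPd_swap hsmooth horth]
  push_cast
  rfl

lemma cyclicRows_of_unitEigen (hsmooth : ∀ u v, ContDiff ℝ (⊤ : ℕ∞) (fun p => a p u v))
    (horth : ∀ p, (a p)ᵀ * a p = 1) {p : Fin n → ℝ}
    (h : ∀ i k, (1 + a p).mulVec (formBracket (alphaForm a i) (alphaForm a k) p) =
          (1 - a p).mulVec (lieBracket (alphaForm a i) (alphaForm a k) p))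
    {x y z : Fin n → ℂ} {lx ly lz : ℂ} (hx : UnitEigen (a p) lx x) (hy : UnitEigen (a p) ly y)
    (hz : UnitEigen (a p) lz z) :
    CyclicRows lx ly lz (lx * contract₃ (logTensor a p) x y z)
      (ly * contract₃ (logTensor a p) y z x) (lz * contract₃ (logTensor a p) z x y) := by
  have key : ∀ {x y z : Fin n → ℂ} {lx ly lz : ℂ}, UnitEigen (a p) lx x → UnitEigen (a p) ly y →
      UnitEigen (a p) lz z → (1 + lx) * (2 - (starRingEnd ℂ) ly - (starRingEnd ℂ) lz)
      * (lx * contract₃ (logTensor a p) x y z)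
    + 2 * ((1 - (starRingEnd ℂ) ly) * (ly * contract₃ (logTensor a p) y z x)
      + (1 - (starRingEnd ℂ) lz) * (lz * contract₃ (logTensor a p) z x y)) = 0 :=
    fun {x y z lx ly lz} hx hy hz => by
    have := contract_logPd_relation hsmooth horth h hx.right hx.left hy.right hy.left hz.right
      hz.left
    change _ * contract₃ (logTensor a p) x y z = _ * (_ * contract₃ (logTensor a p) y z x
      + _ * contract₃ (logTensor a p) z x y) at this
    linear_combination lx * this
      + 2 * ((1 - ly) * contract₃ (logTensor a p) y z x
        + (1 - lz) * contract₃ (logTensor a p) z x y) * hx.unit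
      - 2 * contract₃ (logTensor a p) y z x * hy.unit
      - 2 * contract₃ (logTensor a p) z x y * hz.unit
  exact ⟨hx.unit, hy.unit, hz.unit, key hx hy hz, key hy hz hx, key hz hx hy⟩

end

/-- The derivative of `X ↦ X ^ k` at `M` in the direction `D`, in a noncommutative ring. -/
def powDeriv {R : Type*} [Ring R] (M D : R) : ℕ → R
  | 0 => 0
  | k + 1 => powDeriv M D k * M + M ^ k * D

lemma trace_pow_mul_powDeriv {n : ℕ} (M D : Matrix (Fin n) (Fin n) ℝ) (m k : ℕ) :
    (M ^ (m + 1) * powDeriv M D k).trace = k * (M ^ (m + k) * D).trace := by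
  induction k generalizing m with
  | zero => simp [powDeriv]
  | succ k ih =>
    rw [powDeriv, mul_add, trace_add, ← mul_assoc, trace_mul_comm, ← mul_assoc, ← pow_succ', ih,
      ← mul_assoc, ← pow_add, add_right_comm m 1 k, add_assoc m k 1]
    push_cast
    ring

lemma trace_powDeriv_succ {n : ℕ} (M D : Matrix (Fin n) (Fin n) ℝ) (k : ℕ) :
    (powDeriv M D (k + 1)).trace = (k + 1) * (M ^ k * D).trace := by
  have := trace_pow_mul_powDeriv M D 0 k
  rw [zero_add, zero_add, pow_one, trace_mul_comm] at this
  rw [powDeriv, trace_add, this]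
  ring

section
variable {n : ℕ} {a : (Fin n → ℝ) → Matrix (Fin n) (Fin n) ℝ}

lemma contDiff_pow_apply (hsmooth : ∀ u v, ContDiff ℝ (⊤ : ℕ∞) (fun p => a p u v)) (k : ℕ)
    (i j : Fin n) : ContDiff ℝ (⊤ : ℕ∞) (fun p => (a p ^ k) i j) := by
  induction k generalizing i j with
  | zero => simpa using contDiff_const
  | succ k ih =>
    simp only [pow_succ, mul_apply]
    exact ContDiff.sum fun t _ => (ih i t).mul (hsmooth t j)

lemma pd_pow_apply (hsmooth : ∀ u v, ContDiff ℝ (⊤ : ℕ∞) (fun p => a p u v)) (l : Fin n) (k : ℕ)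
    (i j : Fin n) (p : Fin n → ℝ) : pd l (fun q => (a q ^ k) i j) p
      = powDeriv (a p) (of fun u v => pd l (fun q => a q u v) p) k i j := by
  induction k generalizing i j with
  | zero => simpa [powDeriv] using pd_const _ p l
  | succ k ih =>
    have hd : ∀ u v, DifferentiableAt ℝ (fun q => a q u v) p := fun u v =>
      ((hsmooth u v).differentiable (by simp)).differentiableAt
    have hd' : ∀ u v, DifferentiableAt ℝ (fun q => (a q ^ k) u v) p := fun u v =>
      ((contDiff_pow_apply hsmooth k u v).differentiable (by simp)).differentiableAt
    simp only [pow_succ, mul_apply]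
    rw [pd_sum _ fun t _ => (hd' i t).fun_mul (hd t j)]
    simp only [pd_mul (hd' i _) (hd _ j), ih, powDeriv, Matrix.add_apply, mul_apply, of_apply,
      Finset.sum_add_distrib]

end

lemma abs_apply_le_one_of_orthogonal {n : ℕ} {A : Matrix (Fin n) (Fin n) ℝ} (hA : Aᵀ * A = 1)
    (i j : Fin n) : |A i j| ≤ 1 := by
  have h : (Aᵀ * A) j j = 1 := by rw [hA, one_apply_eq]
  rw [mul_apply] at h
  have := Finset.single_le_sum (f := fun t => Aᵀ j t * A t j)
    (fun t _ => mul_self_nonneg (A t j)) (Finset.mem_univ i)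
  rw [h] at this
  simp only [transpose_apply] at this
  exact abs_le_one_iff_mul_self_le_one.2 this

lemma pow_orthogonal {n : ℕ} {A : Matrix (Fin n) (Fin n) ℝ} (hA : Aᵀ * A = 1) (k : ℕ) :
    (A ^ k)ᵀ * A ^ k = 1 := by
  induction k with
  | zero => simp
  | succ k ih =>
    rw [pow_succ', transpose_mul, mul_assoc, ← mul_assoc Aᵀ, hA, one_mul, ih]

lemma abs_trace_pow_le {n : ℕ} {A : Matrix (Fin n) (Fin n) ℝ} (hA : Aᵀ * A = 1) (k : ℕ) :
    |(A ^ k).trace| ≤ n := by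
  refine (Finset.abs_sum_le_sum_abs _ _).trans ?_
  refine (Finset.sum_le_sum fun i _ => abs_apply_le_one_of_orthogonal (pow_orthogonal hA k) i i).trans ?_
  simp

/-- A unitary matrix `V` whose rows are eigenvectors of `A` with eigenvalues `c`. -/
structure UnitEigenbasis {n : ℕ} (A : Matrix (Fin n) (Fin n) ℝ) (V : Matrix (Fin n) (Fin n) ℂ)
    (c : Fin n → ℂ) : Prop where
  eigen : ∀ α, UnitEigen A (c α) (V α)
  unitary : V * Vᴴ = 1

lemma exists_unitEigenbasis {n : ℕ} {A : Matrix (Fin n) (Fin n) ℝ} (hA : Aᵀ * A = 1) :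
    ∃ V c, UnitEigenbasis A V c := by
  obtain ⟨V, c, h₁, h₂, h₃, h₄⟩ := exists_unitary_diagonalization hA
  exact ⟨V, c, fun α => ⟨h₁ α, h₂ α, h₃ α⟩, h₄⟩

section
variable {n : ℕ} {A : Matrix (Fin n) (Fin n) ℝ} {V : Matrix (Fin n) (Fin n) ℂ} {c : Fin n → ℂ}

lemma UnitEigenbasis.sum_mul_conj (h : UnitEigenbasis A V c) (s t : Fin n) :
    ∑ α, V α s * (starRingEnd ℂ) (V α t) = if s = t then 1 else 0 := by
  have hV : Vᴴ * V = 1 := mul_eq_one_comm.1 h.unitary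
  have := congrFun (congrFun hV t) s
  rw [mul_apply, one_apply] at this
  simp only [eq_comm (a := s), ← this, conjTranspose_apply, mul_comm (V _ s)]
  rfl

/-- A vector orthogonal to all the basis vectors vanishes. -/
lemma UnitEigenbasis.eq_zero (h : UnitEigenbasis A V c) {f : Fin n → ℂ}
    (hf : ∀ α, ∑ s, V α s * f s = 0) : f = 0 := by
  funext t
  have : ∑ α, (starRingEnd ℂ) (V α t) * ∑ s, V α s * f s = f t := by
    simp_rw [Finset.mul_sum]
    rw [Finset.sum_comm]
    simp_rw [← mul_assoc, mul_comm ((starRingEnd ℂ) _), ← Finset.sum_mul, h.sum_mul_conj]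
    simp
  rw [← this]
  simp [hf]

lemma UnitEigenbasis.pow_apply (h : UnitEigenbasis A V c) (k : ℕ) (i j : Fin n) :
    ((A ^ k) i j : ℂ) = ∑ α, c α ^ k * (V α i * (starRingEnd ℂ) (V α j)) := by
  have : ∀ α, c α ^ k * (V α i * (starRingEnd ℂ) (V α j))
      = ∑ s, ((A ^ k) i s : ℂ) * (V α s * (starRingEnd ℂ) (V α j)) := fun α => by
    rw [← mul_assoc, ← (h.eigen α).right_pow, Finset.sum_mul]
    exact Finset.sum_congr rfl fun s _ => by ring
  simp_rw [this]
  rw [Finset.sum_comm]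
  simp_rw [← Finset.mul_sum, h.sum_mul_conj]
  simp

/-- Contraction of `tr (A ^ k S_l)` in a direction `w`. -/
lemma UnitEigenbasis.sum_mul_trace (h : UnitEigenbasis A V c) (T : Fin n → Fin n → Fin n → ℂ)
    (w : Fin n → ℂ) (k : ℕ) : ∑ l, w l * ∑ i, ∑ j, ((A ^ k) i j : ℂ) * T l j i
      = ∑ α, c α ^ k * contract₃ T w (fun t => (starRingEnd ℂ) (V α t)) (V α) := by
  simp_rw [h.pow_apply, contract₃, Finset.mul_sum, Finset.sum_mul, Finset.mul_sum]
  conv_rhs => rw [Finset.sum_comm]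
  refine Finset.sum_congr rfl fun l _ => ?_
  rw [Finset.sum_comm]
  conv_rhs => rw [Finset.sum_comm]
  refine Finset.sum_congr rfl fun j _ => ?_
  conv_rhs => rw [Finset.sum_comm]
  exact Finset.sum_congr rfl fun i _ => Finset.sum_congr rfl fun α _ => by ring

end

section
variable {n : ℕ} {a : (Fin n → ℝ) → Matrix (Fin n) (Fin n) ℝ}

lemma pd_trace_pow_succ (hsmooth : ∀ u v, ContDiff ℝ (⊤ : ℕ∞) (fun p => a p u v))
    (horth : ∀ p, (a p)ᵀ * a p = 1) (l : Fin n) (k : ℕ) (p : Fin n → ℝ) :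
    pd l (fun q => (a q ^ (k + 1)).trace) p
      = (k + 1) * ∑ i, ∑ j, (a p ^ (k + 1)) i j * logPd a p l j i := by
  have hd' : ∀ u v, DifferentiableAt ℝ (fun q => (a q ^ (k + 1)) u v) p := fun u v =>
    ((contDiff_pow_apply hsmooth (k + 1) u v).differentiable (by simp)).differentiableAt
  have hD : (of fun u v => pd l (fun q => a q u v) p) = a p * of (logPd a p l) := by
    ext u v
    rw [of_apply, pd_eq_sum_logPd horth, mul_apply]
    rfl
  have e := trace_powDeriv_succ (a p) (of fun u v => pd l (fun q => a q u v) p) k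
  rw [hD, ← mul_assoc, ← pow_succ, ← hD] at e
  simp only [trace, diag_apply]
  rw [pd_sum _ fun i _ => hd' i i]
  simp only [pd_pow_apply hsmooth]
  exact e.trans (by simp [trace, mul_apply])

lemma trace_pow_mul_logPd_periodic (hsmooth : ∀ u v, ContDiff ℝ (⊤ : ℕ∞) (fun p => a p u v))
    (horth : ∀ p, (a p)ᵀ * a p = 1) {p : Fin n → ℝ}
    (h : ∀ i k, (1 + a p).mulVec (formBracket (alphaForm a i) (alphaForm a k) p) =
          (1 - a p).mulVec (lieBracket (alphaForm a i) (alphaForm a k) p)) (l : Fin n) (k : ℕ) :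
    ∑ i, ∑ j, (a p ^ (k + 12)) i j * logPd a p l j i
      = ∑ i, ∑ j, (a p ^ k) i j * logPd a p l j i := by
  obtain ⟨V, c, hV⟩ := exists_unitEigenbasis (horth p)
  have := congrFun (hV.eq_zero (f := fun l =>
    ∑ i, ∑ j, ((a p ^ (k + 12)) i j : ℂ) * logTensor a p l j i
      - ∑ i, ∑ j, ((a p ^ k) i j : ℂ) * logTensor a p l j i) fun β => ?_) l
  · have := sub_eq_zero.1 this
    simp only [logTensor] at this
    exact_mod_cast this
  · simp_rw [mul_sub, Finset.sum_sub_distrib]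
    rw [hV.sum_mul_trace, hV.sum_mul_trace, sub_eq_zero]
    refine Finset.sum_congr rfl fun α _ => ?_
    by_cases h0 : contract₃ (logTensor a p) (V β) (fun t => (starRingEnd ℂ) (V α t)) (V α) = 0
    · rw [h0, mul_zero, mul_zero]
    have hrow := cyclicRows_of_unitEigen hsmooth horth h (hV.eigen β) (hV.eigen α)
      (hV.eigen α).conj
    have hc : c α ^ 12 = 1 := hrow.pow_twelve_eq_one (mul_ne_zero (fun h1 => ?_) ?_)
    · rw [pow_add, hc, mul_one]
    · have := (hV.eigen β).unit
      rw [h1, mul_zero] at this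
      exact zero_ne_one this
    · rw [contract₃_logTensor_swap hsmooth horth]
      exact neg_ne_zero.2 h0

lemma trace_pow_eq (hsmooth : ∀ u v, ContDiff ℝ (⊤ : ℕ∞) (fun p => a p u v))
    (horth : ∀ p, (a p)ᵀ * a p = 1)
    (h : ∀ i k p, (1 + a p).mulVec (formBracket (alphaForm a i) (alphaForm a k) p) =
          (1 - a p).mulVec (lieBracket (alphaForm a i) (alphaForm a k) p)) (k : ℕ)
    (p q : Fin n → ℝ) : (a p ^ k).trace = (a q ^ k).trace := by
  cases k with
  | zero => simp
  | succ k =>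
    have hper : ∀ m l p, ∑ i, ∑ j, (a p ^ (k + 12 * m + 1)) i j * logPd a p l j i
        = ∑ i, ∑ j, (a p ^ (k + 1)) i j * logPd a p l j i := fun m l p => by
      induction m with
      | zero => rfl
      | succ m ih =>
        rw [← ih, ← trace_pow_mul_logPd_periodic hsmooth horth (fun i k => h i k p) l
          (k + 12 * m + 1)]
        rfl
    have hf : ∀ k, Differentiable ℝ fun q => (a q ^ k).trace := fun k => by
      simp only [trace, diag_apply]
      exact Differentiable.fun_sum fun i _ =>
        (contDiff_pow_apply hsmooth k i i).differentiable (by simp)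
    have hdiff : ∀ m : ℕ, (a p ^ (k + 1)).trace - (a q ^ (k + 1)).trace
        = (k + 1) / ((k + 12 * m : ℕ) + 1) *
          ((a p ^ (k + 12 * m + 1)).trace - (a q ^ (k + 12 * m + 1)).trace) := fun m => by
      set r : ℝ := (k + 1) / ((k + 12 * m : ℕ) + 1) with hr
      have hr' : r * ((k + 12 * m : ℕ) + 1) = k + 1 := div_mul_cancel₀ _ (by positivity)
      have := eq_of_pd_eq_zero (f := fun q => (a q ^ (k + 1)).trace
        - r * (a q ^ (k + 12 * m + 1)).trace) ((hf _).sub ((hf _).const_mul r)) (fun l p => by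
          rw [pd_sub (hf _ p) ((hf _ p).const_mul r),
            pd_mul (differentiableAt_const r) (hf _ p), pd_const, pd_trace_pow_succ hsmooth horth,
            pd_trace_pow_succ hsmooth horth, hper, ← mul_assoc, hr']
          ring) p q
      linear_combination this
    have hb : ∀ m : ℕ, |(a p ^ (k + 1)).trace - (a q ^ (k + 1)).trace|
        ≤ 2 * n * (k + 1) * (1 / ((m : ℝ) + 1)) := fun m => by
      rw [hdiff m, abs_mul, abs_of_nonneg (by positivity)]
      have h1 : |(a p ^ (k + 12 * m + 1)).trace - (a q ^ (k + 12 * m + 1)).trace| ≤ 2 * n :=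
        (abs_sub _ _).trans (by
          linarith [abs_trace_pow_le (horth p) (k + 12 * m + 1),
            abs_trace_pow_le (horth q) (k + 12 * m + 1)])
      have h2 : ((k : ℝ) + 1) / ((k + 12 * m : ℕ) + 1) ≤ (k + 1) * (1 / ((m : ℝ) + 1)) := by
        rw [mul_one_div]
        refine div_le_div_of_nonneg_left (by positivity) (by positivity) ?_
        push_cast
        linarith [(Nat.cast_nonneg k : (0 : ℝ) ≤ k), (Nat.cast_nonneg m : (0 : ℝ) ≤ m)]
      calc _ ≤ (k + 1) * (1 / ((m : ℝ) + 1)) * (2 * n) :=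
            mul_le_mul h2 h1 (abs_nonneg _) (by positivity)
        _ = _ := by ring
    have hlim := (tendsto_one_div_add_atTop_nhds_zero_nat (𝕜 := ℝ)).const_mul
      (2 * n * ((k : ℝ) + 1))
    rw [mul_zero] at hlim
    exact sub_eq_zero.1 (abs_nonpos_iff.1 (ge_of_tendsto' hlim hb))

end

section
variable {n : ℕ} {A B : Matrix (Fin n) (Fin n) ℝ} {V W : Matrix (Fin n) (Fin n) ℂ}
  {c d : Fin n → ℂ}

lemma UnitEigenbasis.sum_pow (h : UnitEigenbasis A V c) (k : ℕ) :
    ∑ α, c α ^ k = ((A ^ k).trace : ℂ) := by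
  simp only [trace, diag_apply, Complex.ofReal_sum, h.pow_apply]
  rw [Finset.sum_comm]
  refine Finset.sum_congr rfl fun α _ => ?_
  have := congrFun (congrFun h.unitary α) α
  rw [mul_apply, one_apply_eq] at this
  rw [← Finset.mul_sum, ← mul_one (c α ^ k)]
  congr 1
  rw [mul_one]
  exact this.symm

lemma UnitEigenbasis.sum_conj_pow_mul_pow (h : UnitEigenbasis A V c) (k m : ℕ) :
    ∑ α, (starRingEnd ℂ) (c α) ^ k * c α ^ m
      = if k ≤ m then ((A ^ (m - k)).trace : ℂ) else ((A ^ (k - m)).trace : ℂ) := by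
  split_ifs with hkm
  · obtain ⟨m, rfl⟩ := Nat.exists_eq_add_of_le hkm
    rw [Nat.add_sub_cancel_left, ← h.sum_pow]
    refine Finset.sum_congr rfl fun α _ => ?_
    rw [pow_add, ← mul_assoc, ← mul_pow, (h.eigen α).unit, one_pow, one_mul]
  · obtain ⟨k, rfl⟩ := Nat.exists_eq_add_of_le (not_le.1 hkm).le
    rw [Nat.add_sub_cancel_left, ← Complex.conj_ofReal, ← h.sum_pow, map_sum]
    refine Finset.sum_congr rfl fun α _ => ?_
    rw [pow_add, mul_right_comm, ← mul_pow, (h.eigen α).unit, one_pow, one_mul, map_pow]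

/-- Matrices with equal power traces have the same annihilating polynomials. -/
lemma UnitEigenbasis.eval_eq_zero (hA : UnitEigenbasis A V c) (hB : UnitEigenbasis B W d)
    (htr : ∀ k, (A ^ k).trace = (B ^ k).trace) {f : Polynomial ℂ} (hf : ∀ α, f.eval (c α) = 0)
    (α : Fin n) : f.eval (d α) = 0 := by
  have key : ∀ {A : Matrix (Fin n) (Fin n) ℝ} {V : Matrix (Fin n) (Fin n) ℂ} {c : Fin n → ℂ},
      UnitEigenbasis A V c → ∑ α, (Complex.normSq (f.eval (c α)) : ℂ)
      = ∑ k ∈ Finset.range (f.natDegree + 1), ∑ m ∈ Finset.range (f.natDegree + 1),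
        (starRingEnd ℂ) (f.coeff k) * f.coeff m *
          if k ≤ m then ((A ^ (m - k)).trace : ℂ) else ((A ^ (k - m)).trace : ℂ) :=
    fun {A V c} h => by
    simp_rw [← h.sum_conj_pow_mul_pow, Finset.mul_sum, Complex.normSq_eq_conj_mul_self,
      Polynomial.eval_eq_sum_range, map_sum, Finset.sum_mul_sum]
    rw [Finset.sum_comm]
    refine Finset.sum_congr rfl fun k _ => ?_
    rw [Finset.sum_comm]
    refine Finset.sum_congr rfl fun m _ => Finset.sum_congr rfl fun α _ => ?_
    rw [map_mul, map_pow]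
    ring
  have h0 : ∑ α, (Complex.normSq (f.eval (d α)) : ℂ) = 0 := by
    rw [key hB]
    simp_rw [← htr]
    rw [← key hA]
    simp [hf]
  have h1 : ∑ α, Complex.normSq (f.eval (d α)) = 0 := by exact_mod_cast h0
  exact Complex.normSq_eq_zero.1
    ((Finset.sum_eq_zero_iff_of_nonneg fun _ _ => Complex.normSq_nonneg _).1 h1 α
      (Finset.mem_univ α))

lemma UnitEigenbasis.sum_coeff_mul_pow (h : UnitEigenbasis A V c) {f : Polynomial ℂ}
    (hf : ∀ α, f.eval (c α) = 0) (i j : Fin n) :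
    ∑ k ∈ Finset.range (f.natDegree + 1), f.coeff k * ((A ^ k) i j : ℂ) = 0 := by
  simp_rw [h.pow_apply, Finset.mul_sum]
  rw [Finset.sum_comm]
  refine Finset.sum_eq_zero fun α _ => ?_
  simp_rw [← mul_assoc, ← Finset.sum_mul]
  rw [← Polynomial.eval_eq_sum_range, hf, zero_mul, zero_mul]

end

lemma sum_mul_pd_eq_zero {n : ℕ} {s : Finset ℕ} {φ : ℕ → ℂ} {F : ℕ → (Fin n → ℝ) → ℝ}
    {p : Fin n → ℝ} (hF : ∀ k, DifferentiableAt ℝ (F k) p)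
    (h : ∀ q, ∑ k ∈ s, φ k * (F k q : ℂ) = 0) (l : Fin n) :
    ∑ k ∈ s, φ k * (pd l (F k) p : ℂ) = 0 := by
  have key : ∀ r : ℕ → ℝ, (∀ q, ∑ k ∈ s, r k * F k q = 0) → ∑ k ∈ s, r k * pd l (F k) p = 0 :=
    fun r hr => by
    have h0 : pd l (fun q => ∑ k ∈ s, r k * F k q) p = 0 := by
      rw [funext hr]; exact pd_const 0 p l
    rw [pd_sum _ fun k _ => (hF k).const_mul (r k)] at h0
    rw [← h0]
    refine Finset.sum_congr rfl fun k _ => ?_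
    rw [pd_mul (differentiableAt_const (r k)) (hF k), pd_const, zero_mul, zero_add]
  apply Complex.ext
  · simpa using key (fun k => (φ k).re) fun q => by simpa using congrArg Complex.re (h q)
  · simpa using key (fun k => (φ k).im) fun q => by simpa using congrArg Complex.im (h q)

section
variable {n : ℕ} {A D : Matrix (Fin n) (Fin n) ℝ} {y z : Fin n → ℂ} {ly lz : ℂ}

lemma UnitEigen.sum_mul_mul (hz : UnitEigen A lz z) (y : Fin n → ℂ)
    (M : Matrix (Fin n) (Fin n) ℝ) : ∑ i, ∑ j, y i * z j * ((M * A) i j : ℂ)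
      = lz * ∑ i, ∑ j, y i * z j * (M i j : ℂ) := by
  rw [Finset.mul_sum]
  refine Finset.sum_congr rfl fun i _ => ?_
  simp only [mul_apply, Complex.ofReal_sum, Complex.ofReal_mul, Finset.mul_sum]
  rw [Finset.sum_comm]
  refine Finset.sum_congr rfl fun t _ => ?_
  calc _ = y i * M i t * ∑ j, z j * (A t j : ℂ) := by
        rw [Finset.mul_sum]; exact Finset.sum_congr rfl fun _ _ => by ring
    _ = _ := by rw [hz.right]; ring

lemma UnitEigen.sum_mul_pow_mul (hy : UnitEigen A ly y) (z : Fin n → ℂ) (k : ℕ)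
    (M : Matrix (Fin n) (Fin n) ℝ) : ∑ i, ∑ j, y i * z j * ((A ^ k * M) i j : ℂ)
      = (starRingEnd ℂ) ly ^ k * ∑ i, ∑ j, y i * z j * (M i j : ℂ) := by
  rw [Finset.sum_comm]
  conv_rhs => rw [Finset.sum_comm]
  rw [Finset.mul_sum]
  refine Finset.sum_congr rfl fun j _ => ?_
  simp only [mul_apply, Complex.ofReal_sum, Complex.ofReal_mul, Finset.mul_sum]
  rw [Finset.sum_comm]
  refine Finset.sum_congr rfl fun t _ => ?_
  calc _ = z j * M t j * ∑ i, y i * ((A ^ k) i t : ℂ) := by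
        rw [Finset.mul_sum]; exact Finset.sum_congr rfl fun _ _ => by ring
    _ = _ := by rw [hy.left_pow]; ring

lemma UnitEigen.sum_mul_powDeriv (hy : UnitEigen A ly y) (hz : UnitEigen A lz z)
    (hyz : (starRingEnd ℂ) ly = lz) (k : ℕ) : ∑ i, ∑ j, y i * z j * (powDeriv A D k i j : ℂ)
      = k * lz ^ (k - 1) * ∑ i, ∑ j, y i * z j * (D i j : ℂ) := by
  induction k with
  | zero => simp [powDeriv]
  | succ k ih =>
    simp only [powDeriv, Matrix.add_apply, Complex.ofReal_add, mul_add, Finset.sum_add_distrib]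
    rw [hz.sum_mul_mul, hy.sum_mul_pow_mul, ih, hyz]
    cases k with
    | zero => simp
    | succ k =>
      push_cast
      ring

end

lemma contract₃_logTensor_eq_zero_of_resonance {n : ℕ}
    {a : (Fin n → ℝ) → Matrix (Fin n) (Fin n) ℝ}
    (hsmooth : ∀ u v, ContDiff ℝ (⊤ : ℕ∞) (fun p => a p u v)) (horth : ∀ p, (a p)ᵀ * a p = 1)
    (h : ∀ i k p, (1 + a p).mulVec (formBracket (alphaForm a i) (alphaForm a k) p) =
          (1 - a p).mulVec (lieBracket (alphaForm a i) (alphaForm a k) p)) {p : Fin n → ℝ}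
    {V : Matrix (Fin n) (Fin n) ℂ} {c : Fin n → ℂ} (hV : UnitEigenbasis (a p) V c)
    {y z : Fin n → ℂ} {ly : ℂ} {γ : Fin n} (hy : UnitEigen (a p) ly y)
    (hz : UnitEigen (a p) (c γ) z) (hyz : ly * c γ = 1) (x : Fin n → ℂ) :
    contract₃ (logTensor a p) x y z = 0 := by
  classical
  set f : Polynomial ℂ := ∏ r ∈ Finset.univ.image c, (Polynomial.X - Polynomial.C r) with hf
  have hroot : ∀ α, f.eval (c α) = 0 := fun α => by
    rw [hf, Polynomial.eval_prod]
    exact Finset.prod_eq_zero (Finset.mem_image_of_mem c (Finset.mem_univ α)) (by simp)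
  have hsep : f.Separable := by
    rw [hf, Polynomial.separable_prod_X_sub_C_iff']
    exact fun _ _ _ _ h => h
  have hder : (Polynomial.derivative f).eval (c γ) ≠ 0 := by
    have := hsep.eval₂_derivative_ne_zero (RingHom.id ℂ) (x := c γ) (by simpa using hroot γ)
    simpa using this
  have hann : ∀ q i j, ∑ k ∈ Finset.range (f.natDegree + 1),
      f.coeff k * ((a q ^ k) i j : ℂ) = 0 := fun q i j => by
    obtain ⟨W, d, hW⟩ := exists_unitEigenbasis (horth q)
    exact hW.sum_coeff_mul_pow
      (hV.eval_eq_zero hW (fun k => trace_pow_eq hsmooth horth h k p q) hroot) i j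
  have hly : (starRingEnd ℂ) ly = c γ := by
    linear_combination c γ * hy.unit - (starRingEnd ℂ) ly * hyz
  have hl : ∀ l, ∑ i, ∑ j, y i * z j * logTensor a p l i j = 0 := fun l => by
    set D : Matrix (Fin n) (Fin n) ℝ := of fun u v => pd l (fun q => a q u v) p with hD
    have hpd : ∀ i j, ∑ k ∈ Finset.range (f.natDegree + 1),
        f.coeff k * (powDeriv (a p) D k i j : ℂ) = 0 := fun i j => by
      simp_rw [hD, ← pd_pow_apply hsmooth]
      exact sum_mul_pd_eq_zero (fun k =>
        ((contDiff_pow_apply hsmooth k i j).differentiable (by simp)).differentiableAt)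
        (fun q => hann q i j) l
    have h1 : (Polynomial.derivative f).eval (c γ) * ∑ i, ∑ j, y i * z j * (D i j : ℂ) = 0 := by
      rw [Polynomial.derivative_eval, Polynomial.sum_over_range _ (by simp), Finset.sum_mul]
      simp_rw [mul_assoc (f.coeff _), ← hy.sum_mul_powDeriv hz hly, Finset.mul_sum]
      rw [Finset.sum_comm]
      refine Finset.sum_eq_zero fun i _ => ?_
      rw [Finset.sum_comm]
      refine Finset.sum_eq_zero fun j _ => ?_
      simp_rw [mul_left_comm (f.coeff _), ← Finset.mul_sum, hpd, mul_zero]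
    have h2 := (mul_eq_zero.1 h1).resolve_left hder
    have h3 : D = a p ^ 1 * of (logPd a p l) := by
      ext u v
      rw [hD, of_apply, pd_eq_sum_logPd horth, mul_apply, pow_one]
      rfl
    rw [h3, hy.sum_mul_pow_mul, pow_one, hly] at h2
    exact (mul_eq_zero.1 h2).resolve_left (right_ne_zero_of_mul_eq_one hyz)
  unfold contract₃
  refine Finset.sum_eq_zero fun l _ => ?_
  rw [← mul_zero (x l), ← hl l]
  simp only [Finset.mul_sum, mul_assoc]

section
variable {n : ℕ} {A : Matrix (Fin n) (Fin n) ℝ} {V : Matrix (Fin n) (Fin n) ℂ} {c : Fin n → ℂ}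

lemma UnitEigenbasis.parseval (h : UnitEigenbasis A V c) (F G : Fin n → ℂ) :
    ∑ α, (∑ i, V α i * F i) * (∑ i, (starRingEnd ℂ) (V α i) * G i) = ∑ i, F i * G i := by
  simp_rw [Finset.sum_mul_sum]
  rw [Finset.sum_comm]
  refine Finset.sum_congr rfl fun i _ => ?_
  rw [Finset.sum_comm]
  calc _ = ∑ j, (∑ α, V α i * (starRingEnd ℂ) (V α j)) * (F i * G j) :=
        Finset.sum_congr rfl fun j _ => by
          rw [Finset.sum_mul]; exact Finset.sum_congr rfl fun _ _ => by ring
    _ = _ := by simp [h.sum_mul_conj]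

lemma contract₃_eq_sum (T : Fin n → Fin n → Fin n → ℂ) (x y z : Fin n → ℂ) :
    contract₃ T x y z = ∑ l, x l * ∑ i, y i * ∑ k, z k * T l i k := by
  simp only [contract₃, Finset.mul_sum, mul_assoc]

lemma contract₃_conj (T : Fin n → Fin n → Fin n → ℝ) (x y z : Fin n → ℂ) :
    contract₃ (fun l i k => (T l i k : ℂ)) (fun t => (starRingEnd ℂ) (x t))
      (fun t => (starRingEnd ℂ) (y t)) (fun t => (starRingEnd ℂ) (z t))
      = (starRingEnd ℂ) (contract₃ (fun l i k => (T l i k : ℂ)) x y z) := by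
  simp only [contract₃, map_sum, map_mul, Complex.conj_ofReal]

lemma UnitEigenbasis.parseval_contract₃ (h : UnitEigenbasis A V c)
    (H K : Fin n → Fin n → Fin n → ℂ) :
    ∑ γ, ∑ β, ∑ α, contract₃ H (V α) (V β) (V γ) *
      contract₃ K (fun t => (starRingEnd ℂ) (V α t)) (fun t => (starRingEnd ℂ) (V β t))
        (fun t => (starRingEnd ℂ) (V γ t)) = ∑ i, ∑ j, ∑ k, H i j k * K i j k := by
  simp_rw [contract₃_eq_sum, h.parseval]
  rw [Finset.sum_congr rfl fun γ _ => Finset.sum_comm]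
  simp_rw [h.parseval]
  rw [Finset.sum_comm]
  refine Finset.sum_congr rfl fun i _ => ?_
  rw [Finset.sum_comm]
  simp_rw [h.parseval]

/-- Contraction of an array against `A` in the first and last slots. -/
lemma UnitEigenbasis.sum_sum_apply_mul_eq_zero (h : UnitEigenbasis A V c)
    {T : Fin n → Fin n → Fin n → ℂ}
    (hT : ∀ β γ, contract₃ T (V β) (V γ) (fun t => (starRingEnd ℂ) (V β t)) = 0) (m : Fin n) :
    ∑ j, ∑ k, (A j k : ℂ) * T j m k = 0 := by
  refine congrFun (h.eq_zero (f := fun m => ∑ j, ∑ k, (A j k : ℂ) * T j m k) fun γ => ?_) m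
  calc _ = ∑ β, c β * contract₃ T (V β) (V γ) (fun t => (starRingEnd ℂ) (V β t)) := by
        have hA : ∀ i j, (A i j : ℂ) = ∑ α, c α * (V α i * (starRingEnd ℂ) (V α j)) := fun i j => by
          simpa using h.pow_apply 1 i j
        simp_rw [hA, contract₃, Finset.sum_mul, Finset.mul_sum]
        rw [Finset.sum_comm]
        conv_rhs => rw [Finset.sum_comm]
        refine Finset.sum_congr rfl fun j _ => ?_
        conv_rhs => rw [Finset.sum_comm]
        refine Finset.sum_congr rfl fun m _ => ?_
        conv_rhs => rw [Finset.sum_comm]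
        exact Finset.sum_congr rfl fun k _ => Finset.sum_congr rfl fun β _ => by ring
    _ = 0 := by simp [hT]

end

/-- If each cyclic triple is either zero or strictly sub-additive for `normSq`, and the cyclic
correlations cancel, then everything vanishes. -/
lemma eq_zero_of_cyclic_normSq_lt {ι : Type*} [Fintype ι] (σ : ι ≃ ι) (hσ : ∀ e, σ (σ (σ e)) = e)
    {X : ι → ℂ} (h : ∀ e, (X e = 0 ∧ X (σ e) = 0 ∧ X (σ (σ e)) = 0) ∨
      Complex.normSq (X e + X (σ e) + X (σ (σ e)))
        < Complex.normSq (X e) + Complex.normSq (X (σ e)) + Complex.normSq (X (σ (σ e))))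
    (hX : ∑ e, (starRingEnd ℂ) (X e) * X (σ e) = 0) (e : ι) : X e = 0 := by
  set r : ι → ℝ := fun e => ((starRingEnd ℂ) (X e) * X (σ e)).re with hr
  have hr0 : ∑ e, r e = 0 := by
    have := congrArg Complex.re hX
    rwa [Complex.re_sum] at this
  have hr1 : ∑ e, r (σ e) = 0 := by rw [σ.sum_comp r]; exact hr0
  have hr2 : ∑ e, r (σ (σ e)) = 0 := by rw [σ.sum_comp fun e => r (σ e)]; exact hr1
  have key : ∀ e, r e + r (σ e) + r (σ (σ e))
      = (Complex.normSq (X e + X (σ e) + X (σ (σ e))) - (Complex.normSq (X e)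
        + Complex.normSq (X (σ e)) + Complex.normSq (X (σ (σ e))))) / 2 := fun e => by
    simp only [hr, hσ, Complex.normSq_apply, Complex.mul_re, Complex.conj_re, Complex.conj_im,
      Complex.add_re, Complex.add_im]
    ring
  have hle : ∀ e, 0 ≤ -(r e + r (σ e) + r (σ (σ e))) := fun e => by
    rw [key]
    rcases h e with ⟨h1, h2, h3⟩ | h
    · simp [h1, h2, h3]
    · linarith
  have hsum : ∑ e, -(r e + r (σ e) + r (σ (σ e))) = 0 := by
    rw [Finset.sum_neg_distrib, Finset.sum_add_distrib, Finset.sum_add_distrib, hr0, hr1, hr2]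
    simp
  have h0 := (Finset.sum_eq_zero_iff_of_nonneg fun e _ => hle e).1 hsum e (Finset.mem_univ e)
  rcases h e with h | h
  · exact h.1
  · rw [key] at h0
    linarith

/-- Integrability forces all partial derivatives to vanish. -/
theorem pd_eq_zero_of_integrable {n : ℕ} {a : (Fin n → ℝ) → Matrix (Fin n) (Fin n) ℝ}
    (hsmooth : ∀ u v, ContDiff ℝ (⊤ : ℕ∞) (fun p => a p u v)) (horth : ∀ p, (a p)ᵀ * a p = 1)
    (h : ∀ i k p, (1 + a p).mulVec (formBracket (alphaForm a i) (alphaForm a k) p) =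
          (1 - a p).mulVec (lieBracket (alphaForm a i) (alphaForm a k) p)) (l m k : Fin n)
    (p : Fin n → ℝ) : pd l (fun q => a q m k) p = 0 := by
  have htrace : ∀ p m, ∑ j, ∑ k, a p j k * logPd a p j m k = 0 := fun p m => by
    obtain ⟨V, c, hV⟩ := exists_unitEigenbasis (horth p)
    have hres : ∀ {y : Fin n → ℂ} {ly : ℂ} {γ : Fin n}, UnitEigen (a p) ly y → ly * c γ = 1 →
        ∀ x, contract₃ (logTensor a p) x y (V γ) = 0 := fun {y ly γ} hy hyz x =>
      contract₃_logTensor_eq_zero_of_resonance hsmooth horth h hV hy (hV.eigen γ) hyz x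
    have := hV.sum_sum_apply_mul_eq_zero (T := logTensor a p) (fun β γ => ?_) m
    · simp only [logTensor] at this
      exact_mod_cast this
    · have hu := (hV.eigen β).unit
      have := (cyclicRows_of_unitEigen hsmooth horth (fun i k => h i k p) (hV.eigen γ)
        (hV.eigen β).conj (hV.eigen β)).eq_zero_of_resonance
        ⟨fun e => by rw [hres (hV.eigen β).conj e, mul_zero],
          fun e => by rw [hres (hV.eigen β) e, mul_zero],
          fun e => by
            rw [contract₃_logTensor_swap hsmooth horth, hres (hV.eigen β).conj
              ((mul_comm _ _).trans e), neg_zero, mul_zero]⟩ hu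
      exact (mul_eq_zero.1 this.2.2).resolve_left (right_ne_zero_of_mul_eq_one hu)
  have hQ := sum_pd_mul_pd_eq_zero hsmooth (fun p i => by
    simp_rw [pd_eq_sum_logPd horth, Finset.mul_sum]
    rw [Finset.sum_congr rfl fun j _ => Finset.sum_comm, Finset.sum_comm]
    refine Finset.sum_eq_zero fun t _ => ?_
    rw [← mul_zero (a p i t), ← htrace p t]
    simp only [Finset.mul_sum]
    exact Finset.sum_congr rfl fun j _ => Finset.sum_congr rfl fun k _ => by ring) (fun p k => by
    rw [← neg_eq_zero, ← htrace p k, ← Finset.sum_neg_distrib]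
    refine Finset.sum_congr rfl fun i _ => ?_
    rw [pd_eq_sum_logPd horth, ← Finset.sum_neg_distrib]
    refine Finset.sum_congr rfl fun t _ => ?_
    rw [logPd_swap hsmooth horth p i t k, mul_neg]) p
  obtain ⟨V, c, hV⟩ := exists_unitEigenbasis (horth p)
  set H : Fin n → Fin n → Fin n → ℂ := fun i j k => ∑ t, (a p j t : ℂ) * logTensor a p i t k
    with hH
  have hHpd : ∀ i j k, H i j k = (pd i (fun q => a q j k) p : ℂ) := fun i j k => by
    rw [pd_eq_sum_logPd horth]
    simp only [hH, logTensor]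
    push_cast
    rfl
  have hH0 : ∑ i, ∑ j, ∑ k, H i j k * H j i k = 0 := by
    simp_rw [hHpd]
    exact_mod_cast hQ
  have hHc : ∀ {x y z : Fin n → ℂ} {ly : ℂ}, UnitEigen (a p) ly y →
      contract₃ H x y z = (starRingEnd ℂ) ly * contract₃ (logTensor a p) x y z :=
    fun hy => contract₃_slot₂ (M := fun l t => (a p l t : ℂ)) _ hy.left
  have hX := eq_zero_of_cyclic_normSq_lt (cycleTriple (Fin n)) (fun _ => rfl)
    (X := fun e => c e.1 * contract₃ (logTensor a p) (V e.1) (V e.2.1) (V e.2.2)) (fun e => ?_) ?_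
  · have hC : ∀ α β γ, contract₃ (logTensor a p) (V α) (V β) (V γ) = 0 := fun α β γ =>
      (mul_eq_zero.1 (hX (α, β, γ))).resolve_left
        (right_ne_zero_of_mul_eq_one (hV.eigen α).unit)
    have hS := hV.parseval_contract₃ (logTensor a p) (logTensor a p)
    simp only [hC, zero_mul, Finset.sum_const_zero, logTensor] at hS
    have hS : ∑ l, ∑ i, ∑ k, logPd a p l i k * logPd a p l i k = 0 := by exact_mod_cast hS.symm
    have hlog : ∀ t, logPd a p l t k = 0 := fun t => by
      have h₁ := (Finset.sum_eq_zero_iff_of_nonneg fun l _ => Finset.sum_nonneg fun i _ =>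
        Finset.sum_nonneg fun k _ => mul_self_nonneg (logPd a p l i k)).1 hS l (Finset.mem_univ l)
      have h₂ := (Finset.sum_eq_zero_iff_of_nonneg fun i _ =>
        Finset.sum_nonneg fun k _ => mul_self_nonneg (logPd a p l i k)).1 h₁ t (Finset.mem_univ t)
      exact mul_self_eq_zero.1 ((Finset.sum_eq_zero_iff_of_nonneg fun k _ =>
        mul_self_nonneg (logPd a p l t k)).1 h₂ k (Finset.mem_univ k))
    rw [pd_eq_sum_logPd horth]
    simp [hlog]
  · obtain ⟨α, β, γ⟩ := e
    have hres : ∀ α β γ, c α * c β = 1 → c γ * contract₃ (logTensor a p) (V γ) (V α) (V β) = 0 :=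
      fun α β γ e => by
      rw [contract₃_logTensor_eq_zero_of_resonance hsmooth horth h hV (hV.eigen α) (hV.eigen β) e,
        mul_zero]
    exact (cyclicRows_of_unitEigen hsmooth horth (fun i k => h i k p) (hV.eigen α) (hV.eigen β)
      (hV.eigen γ)).eq_zero_or_normSq_lt ⟨hres _ _ _, hres _ _ _, hres _ _ _⟩
  · rw [← hV.parseval_contract₃ H fun i j k => H j i k] at hH0
    simp_rw [contract₃_swap₁₂, hHc (hV.eigen _), hHc (hV.eigen _).conj] at hH0
    have hconj := congrArg (starRingEnd ℂ) hH0
    rw [map_zero] at hconj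
    simp only [Fintype.sum_prod_type]
    rw [← neg_eq_zero, ← hconj, Finset.sum_congr rfl fun α _ => Finset.sum_comm, Finset.sum_comm,
      Finset.sum_congr rfl fun γ _ => Finset.sum_comm]
    simp only [map_sum, ← Finset.sum_neg_distrib]
    refine Finset.sum_congr rfl fun γ _ => Finset.sum_congr rfl fun β _ =>
      Finset.sum_congr rfl fun α _ => ?_
    have hc := contract₃_conj (logPd a p) (V β) (V α) (V γ)
    change contract₃ (logTensor a p) _ _ _ = (starRingEnd ℂ) (contract₃ (logTensor a p) _ _ _) at hc
    have hs := contract₃_logTensor_swap hsmooth horth p (V β) (V α) (V γ)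
    simp only [cycleTriple, Equiv.coe_fn_mk]
    rw [hc, hs]
    simp only [map_mul, Complex.conj_conj]
    ring

lemma brackets_eq_zero_of_pd_eq_zero {n : ℕ} {a : (Fin n → ℝ) → Matrix (Fin n) (Fin n) ℝ}
    (hsmooth : ∀ u v, ContDiff ℝ (⊤ : ℕ∞) (fun p => a p u v))
    (h : ∀ (l m k : Fin n) (p : Fin n → ℝ), pd l (fun q => a q m k) p = 0) (i k : Fin n)
    (p : Fin n → ℝ) : formBracket (alphaForm a i) (alphaForm a k) p = 0 ∧
      lieBracket (alphaForm a i) (alphaForm a k) p = 0 := by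
  have hal : ∀ t l k, pd t (fun q => alphaForm a k q l) p = 0 := fun t l k => by
    simp only [alphaForm]
    rw [pd_sub (differentiableAt_const _)
      ((hsmooth l k).differentiable (by simp)).differentiableAt, pd_const, h, sub_zero]
  have hp : (fun q => pairF (alphaForm a i) (alphaForm a k) q
      - pairF (alphaForm a k) (alphaForm a i) q) = fun _ => (0 : ℝ) := by
    funext q
    simp [pairF, mul_comm]
  constructor
  · funext l
    simp [formBracket, contrD, hal, hp, pd_const]
  · funext l
    simp [lieBracket, hal]

/-- A pointwise-orthogonal smooth matrix field `A : ℝⁿ → Mₙ(ℝ)` is integrable, i.e.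
`(I+A){(I−A)dx_i, (I−A)dx_k} = (I−A)[X_{(I−A)dx_i}, X_{(I−A)dx_k}]` for all `i, k`,
if and only if for all `m, i, k`:
`∂_i(a_{mk}) − ∂_k(a_{mi}) + Σ_l (a_{li}∂_l(a_{mk}) − a_{lk}∂_l(a_{mi}))
  + Σ_j a_{ji}∂_m(a_{jk}) + Σ_{l,j} a_{mj} a_{lj} ∂_j(a_{lk}) = 0` on `ℝⁿ`. -/
theorem integrable_iff_pde {n : ℕ} (hn : 1 ≤ n)
    (a : (Fin n → ℝ) → Matrix (Fin n) (Fin n) ℝ)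
    (hsmooth : ∀ u v : Fin n, ContDiff ℝ (⊤ : ℕ∞) (fun p => a p u v))
    (horth : ∀ p : Fin n → ℝ, (a p)ᵀ * a p = 1) :
    (∀ (i k : Fin n) (p : Fin n → ℝ),
        (1 + a p).mulVec (formBracket (alphaForm a i) (alphaForm a k) p) =
          (1 - a p).mulVec (lieBracket (alphaForm a i) (alphaForm a k) p)) ↔
    (∀ (m i k : Fin n) (p : Fin n → ℝ),
        pd i (fun q => a q m k) p - pd k (fun q => a q m i) p
          + (∑ l : Fin n, (a p l i * pd l (fun q => a q m k) p
              - a p l k * pd l (fun q => a q m i) p))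
          + (∑ j : Fin n, a p j i * pd m (fun q => a q j k) p)
          + (∑ l : Fin n, ∑ j : Fin n, a p m j * a p l j * pd j (fun q => a q l k) p)
        = 0) := by
  constructor
  · intro h m i k p
    simp [pd_eq_zero_of_integrable hsmooth horth h]
  · intro h i k p
    obtain ⟨h₁, h₂⟩ := brackets_eq_zero_of_pd_eq_zero hsmooth
      (pd_eq_zero_of_pde hsmooth horth h) i k p
    rw [h₁, h₂, mulVec_zero, mulVec_zero]
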